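/- arXiv:math/0306087 — 10 statements merged into one kernel-verified Lean document; each statement's English description precedes it below -/
import Mathlib

section
/- For all polynomials f, g ∈ ℚ[X], one has f ⊗ g = Σ_{s=0}^{natDegree g} ( ((−1)^s/s!)·X^s·f ⊗ 1 ) * Δ(g^{(s)}) in the ℚ-algebra ℚ[X] ⊗[ℚ] ℚ[X], where g^{(s)} denotes the s-th formal derivative of g and * is the multiplication of the tensor product algebra. -/
open scoped TensorProduct
open Polynomial

/-- The comultiplication `Δ : ℚ[X] → ℚ[X] ⊗ ℚ[X]`, the unique ℚ-algebra
homomorphism determined by `Δ(X) = X ⊗ 1 + 1 ⊗ X`. -/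
noncomputable def Delta : ℚ[X] →ₐ[ℚ] ℚ[X] ⊗[ℚ] ℚ[X] :=
  aeval ((X : ℚ[X]) ⊗ₜ[ℚ] (1 : ℚ[X]) + (1 : ℚ[X]) ⊗ₜ[ℚ] (X : ℚ[X]))

/-- Taylor expansion of a rational polynomial at a point of a commutative `ℚ`-algebra, with
coefficients given by iterated derivatives. -/
theorem Polynomial.aeval_add_eq_sum_iterate_derivative {S : Type*} [CommRing S] [Algebra ℚ S]
    (g : ℚ[X]) (u h : S) :
    aeval (u + h) g = ∑ s ∈ Finset.range (g.natDegree + 1),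
      (1 / (Nat.factorial s : ℚ)) • (h ^ s * aeval u (derivative^[s] g)) := by
  have hcoeff (s : ℕ) : (taylor u (g.map (algebraMap ℚ S))).coeff s =
      (1 / (Nat.factorial s : ℚ)) • aeval u (derivative^[s] g) := by
    have hs : (Nat.factorial s : ℚ) ≠ 0 := by exact_mod_cast s.factorial_ne_zero
    rw [← eval_map_algebraMap, ← iterate_derivative_map, ← factorial_smul_hasseDeriv,
      LinearMap.smul_apply, eval_smul, ← Nat.cast_smul_eq_nsmul ℚ, smul_smul,
      one_div_mul_cancel hs, one_smul, taylor_coeff]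
  have hdeg : (taylor u (g.map (algebraMap ℚ S))).natDegree < g.natDegree + 1 := by
    rw [natDegree_taylor]
    exact Nat.lt_succ_of_le natDegree_map_le
  rw [← eval_map_algebraMap, add_comm, ← taylor_eval, eval_eq_sum_range' hdeg]
  refine Finset.sum_congr rfl fun s _ => ?_
  rw [hcoeff, smul_mul_assoc, mul_comm]

theorem tensor_decomposition (f g : ℚ[X]) :
    f ⊗ₜ[ℚ] g = ∑ s ∈ Finset.range (g.natDegree + 1),
      ((((-1 : ℚ) ^ s / (Nat.factorial s : ℚ)) • ((X : ℚ[X]) ^ s * f)) ⊗ₜ[ℚ] (1 : ℚ[X])) *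
        Delta ((derivative (R := ℚ))^[s] g) := by
  let x : ℚ[X] ⊗[ℚ] ℚ[X] := X ⊗ₜ 1
  let y : ℚ[X] ⊗[ℚ] ℚ[X] := 1 ⊗ₜ X
  have hg : (1 : ℚ[X]) ⊗ₜ[ℚ] g = aeval (x + y + -x) g := by
    rw [add_neg_cancel_comm]
    have := aeval_algHom_apply
      (Algebra.TensorProduct.includeRight : ℚ[X] →ₐ[ℚ] ℚ[X] ⊗[ℚ] ℚ[X]) X g
    rw [aeval_X_left_apply] at this
    exact this.symm
  have hfg : f ⊗ₜ[ℚ] g = (f ⊗ₜ[ℚ] (1 : ℚ[X])) * ((1 : ℚ[X]) ⊗ₜ[ℚ] g) := by simp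
  rw [hfg, hg, aeval_add_eq_sum_iterate_derivative, Finset.mul_sum]
  refine Finset.sum_congr rfl fun s _ => ?_
  have hx : (((-1 : ℚ) ^ s / (Nat.factorial s : ℚ)) • ((X : ℚ[X]) ^ s * f)) ⊗ₜ[ℚ] (1 : ℚ[X]) =
      (1 / (Nat.factorial s : ℚ)) • ((f ⊗ₜ[ℚ] (1 : ℚ[X])) * (-x) ^ s) := by
    have hneg : -x = (-1 : ℚ) • x := (neg_one_smul ℚ x).symm
    rw [hneg, _root_.smul_pow, Algebra.TensorProduct.tmul_pow, mul_smul_comm, smul_smul,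
      Algebra.TensorProduct.tmul_mul_tmul, ← TensorProduct.smul_tmul', one_pow, one_mul,
      mul_comm f, one_div_mul_eq_div]
  rw [hx, smul_mul_assoc, mul_smul_comm, mul_assoc]
  rfl
end

section
/- The ℚ-linear map Φ from the space of finitely supported families (h_t)_{t ∈ ℕ} of polynomials in ℚ[X] to ℚ[X] ⊗[ℚ] ℚ[X], defined by Φ((h_t)_t) = Σ_t ( ((−1)^t/t!)·X^t ⊗ 1 ) * Δ(h_t), is bijective. Equivalently, every element of ℚ[X] ⊗ ℚ[X] is uniquely representable in the form Σ_t ((−X)^t/t! ⊗ 1)·Δ(h_t) with finitely many nonzero h_t ∈ ℚ[X]. -/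
open scoped TensorProduct
open Polynomial

/-- The map `Φ` sending a finitely supported family `(h_t)_{t ∈ ℕ}` of polynomials to
`Σ_t ((−X)^t/t! ⊗ 1) * Δ(h_t)`. -/
noncomputable def Phi (h : ℕ →₀ ℚ[X]) : ℚ[X] ⊗[ℚ] ℚ[X] :=
  h.sum fun t p =>
    ((((-1 : ℚ) ^ t / (Nat.factorial t : ℚ)) • (X : ℚ[X]) ^ t) ⊗ₜ[ℚ] (1 : ℚ[X])) * Delta p

/-- The algebra endomorphism `a ⊗ b ↦ (a ⊗ 1) * Δ(b)` of `ℚ[X] ⊗ ℚ[X]`. -/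
noncomputable def shear : ℚ[X] ⊗[ℚ] ℚ[X] →ₐ[ℚ] ℚ[X] ⊗[ℚ] ℚ[X] :=
  Algebra.TensorProduct.lift Algebra.TensorProduct.includeLeft Delta fun _ _ => .all _ _

/-- The inverse of `shear`: it fixes `X ⊗ 1` and sends `1 ⊗ X` to `1 ⊗ X - X ⊗ 1`. -/
noncomputable def shearInv : ℚ[X] ⊗[ℚ] ℚ[X] →ₐ[ℚ] ℚ[X] ⊗[ℚ] ℚ[X] :=
  Algebra.TensorProduct.lift Algebra.TensorProduct.includeLeft
    (aeval ((1 : ℚ[X]) ⊗ₜ[ℚ] (X : ℚ[X]) - (X : ℚ[X]) ⊗ₜ[ℚ] (1 : ℚ[X]))) fun _ _ => .all _ _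

theorem shearInv_comp_shear : shearInv.comp shear = AlgHom.id ℚ _ := by
  ext <;> simp [shear, shearInv, Delta, ← Algebra.TensorProduct.one_def]

theorem shear_comp_shearInv : shear.comp shearInv = AlgHom.id ℚ _ := by
  ext <;> simp [shear, shearInv, Delta, ← Algebra.TensorProduct.one_def]

theorem shear_bijective : Function.Bijective shear :=
  Function.bijective_iff_has_inverse.mpr
    ⟨shearInv, DFunLike.congr_fun shearInv_comp_shear, DFunLike.congr_fun shear_comp_shearInv⟩

/-- The basis `(-X)^t / t!` of `ℚ[X]`. -/
noncomputable def dividedPowerBasis : Module.Basis ℕ ℚ ℚ[X] :=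
  (basisMonomials ℚ).isUnitSMul (w := fun t => (-1 : ℚ) ^ t / (Nat.factorial t : ℚ))
    fun t => IsUnit.mk0 _ (div_ne_zero (pow_ne_zero _ (by norm_num))
      (Nat.cast_ne_zero.mpr t.factorial_ne_zero))

theorem dividedPowerBasis_apply (t : ℕ) :
    dividedPowerBasis t = ((-1 : ℚ) ^ t / (Nat.factorial t : ℚ)) • (X : ℚ[X]) ^ t := by
  rw [dividedPowerBasis, Module.Basis.isUnitSMul_apply, coe_basisMonomials, X_pow_eq_monomial]

theorem Phi_eq_shear_comp :
    Phi = shear ∘ (TensorProduct.equivFinsuppOfBasisLeft (N := ℚ[X]) dividedPowerBasis).symm := by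
  funext h
  rw [Function.comp_apply, TensorProduct.equivFinsuppOfBasisLeft_symm_apply, map_finsuppSum, Phi]
  refine Finsupp.sum_congr fun t _ => ?_
  rw [dividedPowerBasis_apply, shear, Algebra.TensorProduct.lift_tmul,
    Algebra.TensorProduct.includeLeft_apply]

theorem phi_bijective : Function.Bijective Phi := by
  rw [Phi_eq_shear_comp]
  exact shear_bijective.comp (LinearEquiv.bijective _)
end

section
/- For every u ∈ F there exists N ∈ ℕ such that ∂^s(u) = 0 for all s ≥ N, and for any such N one has Δ_F(u) = Σ_{s=0}^{N} ((1/s!)·X^s) ⊗ ∂^s(u). -/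
open scoped TensorProduct
open Polynomial

/-- The coaction `Δ_F : F → ℚ[X] ⊗ F` on the free algebra
`F = FreeAlgebra ℚ (B ⊕ Unit)`, the unique ℚ-algebra homomorphism with
`Δ_F(a) = 1 ⊗ a` for `a ∈ B` and `Δ_F(v) = X ⊗ 1 + 1 ⊗ v` for the extra
generator `v`. -/
noncomputable def DeltaF (B : Type*) :
    FreeAlgebra ℚ (B ⊕ Unit) →ₐ[ℚ] ℚ[X] ⊗[ℚ] FreeAlgebra ℚ (B ⊕ Unit) :=
  FreeAlgebra.lift ℚ fun x =>
    Sum.elim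
      (fun a => (1 : ℚ[X]) ⊗ₜ[ℚ] FreeAlgebra.ι ℚ (Sum.inl a : B ⊕ Unit))
      (fun _ => (X : ℚ[X]) ⊗ₜ[ℚ] (1 : FreeAlgebra ℚ (B ⊕ Unit)) +
        (1 : ℚ[X]) ⊗ₜ[ℚ] FreeAlgebra.ι ℚ (Sum.inr () : B ⊕ Unit)) x

namespace FreeAlgebra

variable (B : Type*)

/-- The algebra homomorphism fixing the generators from `B` and sending the extra generator `v`
to `X + v`. -/
noncomputable def translation :
    FreeAlgebra ℚ (B ⊕ Unit) →ₐ[ℚ] (FreeAlgebra ℚ (B ⊕ Unit))[X] :=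
  FreeAlgebra.lift ℚ (Sum.elim (fun a => C (ι ℚ (Sum.inl a)))
    (fun _ => X + C (ι ℚ (Sum.inr ()))))

variable {B}

@[simp]
lemma translation_inl (a : B) :
    translation B (ι ℚ (Sum.inl a)) = C (ι ℚ (Sum.inl a)) := by
  simp [translation]

@[simp]
lemma translation_inr :
    translation B (ι ℚ (Sum.inr ())) = X + C (ι ℚ (Sum.inr ())) := by
  simp [translation]

lemma coeff_zero_translation (u : FreeAlgebra ℚ (B ⊕ Unit)) :
    (translation B u).coeff 0 = u := by
  induction u using FreeAlgebra.induction with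
  | grade0 r => rw [AlgHom.commutes, Polynomial.algebraMap_apply, coeff_C_zero]
  | grade1 x =>
    match x with
    | .inl a => simp
    | .inr () => simp
  | mul x y hx hy => rw [map_mul, mul_coeff_zero, hx, hy]
  | add x y hx hy => rw [map_add, coeff_add, hx, hy]

lemma deltaF_eq_polyEquivTensor_translation (u : FreeAlgebra ℚ (B ⊕ Unit)) :
    DeltaF B u = Algebra.TensorProduct.comm ℚ _ _
      (polyEquivTensor ℚ (FreeAlgebra ℚ (B ⊕ Unit)) (translation B u)) := by
  induction u using FreeAlgebra.induction with
  | grade0 r => simp only [AlgHom.commutes, AlgEquiv.commutes]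
  | grade1 x =>
    match x with
    | .inl a => simp [DeltaF]
    | .inr () => simp [DeltaF, eval₂_add]
  | mul x y hx hy => simp only [map_mul, hx, hy]
  | add x y hx hy => simp only [map_add, hx, hy]

section Derivation

variable {d : FreeAlgebra ℚ (B ⊕ Unit) →ₗ[ℚ] FreeAlgebra ℚ (B ⊕ Unit)}

lemma derivative_translation
    (hder : ∀ x y, d (x * y) = d x * y + x * d y)
    (hv : d (ι ℚ (Sum.inr ())) = 1) (ha : ∀ a : B, d (ι ℚ (Sum.inl a)) = 0)
    (u : FreeAlgebra ℚ (B ⊕ Unit)) :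
    derivative (translation B u) = translation B (d u) := by
  induction u using FreeAlgebra.induction with
  | grade0 r =>
    have h1 : d 1 = 0 := by simpa using hder 1 1
    rw [AlgHom.commutes, Polynomial.algebraMap_apply, derivative_C, Algebra.algebraMap_eq_smul_one,
      map_smul, h1, smul_zero, map_zero]
  | grade1 x =>
    match x with
    | .inl a => simp [ha]
    | .inr () => simp [hv]
  | mul x y hx hy => rw [map_mul, derivative_mul, hx, hy, hder, map_add, map_mul, map_mul]
  | add x y hx hy => rw [map_add, derivative_add, hx, hy, map_add, map_add]

lemma factorial_smul_coeff_translation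
    (hder : ∀ x y, d (x * y) = d x * y + x * d y)
    (hv : d (ι ℚ (Sum.inr ())) = 1) (ha : ∀ a : B, d (ι ℚ (Sum.inl a)) = 0)
    (s : ℕ) (u : FreeAlgebra ℚ (B ⊕ Unit)) :
    s.factorial • (translation B u).coeff s = d^[s] u := by
  have h : derivative^[s] (translation B u) = translation B (d^[s] u) :=
    ((Function.Semiconj.iterate_right (f := translation B)
      (fun x => (derivative_translation hder hv ha x).symm) s) u).symm
  rw [← coeff_zero_translation (d^[s] u), ← h, coeff_iterate_derivative, zero_add,
    Nat.descFactorial_self]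

end Derivation

end FreeAlgebra

theorem deltaF_eq_sum_divided_derivatives (B : Type*)
    (d : FreeAlgebra ℚ (B ⊕ Unit) →ₗ[ℚ] FreeAlgebra ℚ (B ⊕ Unit))
    (hder : ∀ x y, d (x * y) = d x * y + x * d y)
    (hv : d (FreeAlgebra.ι ℚ (Sum.inr () : B ⊕ Unit)) = 1)
    (ha : ∀ a : B, d (FreeAlgebra.ι ℚ (Sum.inl a : B ⊕ Unit)) = 0)
    (u : FreeAlgebra ℚ (B ⊕ Unit)) :
    (∃ N : ℕ, ∀ s ≥ N, (⇑d)^[s] u = 0) ∧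
    ∀ N : ℕ, (∀ s ≥ N, (⇑d)^[s] u = 0) →
      (DeltaF B) u = ∑ s ∈ Finset.range (N + 1),
        (((1 : ℚ) / (Nat.factorial s : ℚ)) • (X : ℚ[X]) ^ s) ⊗ₜ[ℚ] ((⇑d)^[s] u) := by
  have hcoeff := fun s =>
    FreeAlgebra.factorial_smul_coeff_translation hder hv ha s u
  refine ⟨⟨(FreeAlgebra.translation B u).natDegree + 1, fun s hs => ?_⟩, fun N hN => ?_⟩
  · rw [← hcoeff, coeff_eq_zero_of_natDegree_lt hs, smul_zero]
  have hdiv : ∀ s, (FreeAlgebra.translation B u).coeff s = ((1 : ℚ) / s.factorial) • d^[s] u := fun s => by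
    rw [← hcoeff, ← Nat.cast_smul_eq_nsmul ℚ, smul_smul,
      one_div_mul_cancel (Nat.cast_ne_zero.mpr s.factorial_ne_zero), one_smul]
  have hdeg : (FreeAlgebra.translation B u).natDegree < N + 1 := by
    refine Nat.lt_succ_of_le (natDegree_le_iff_coeff_eq_zero.mpr fun s hs => ?_)
    rw [hdiv, hN s hs.le, smul_zero]
  rw [FreeAlgebra.deltaF_eq_polyEquivTensor_translation, as_sum_range' _ _ hdeg, map_sum, map_sum]
  refine Finset.sum_congr rfl fun s _ => ?_
  rw [hdiv, polyEquivTensor_apply, eval₂_monomial]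
  simp [TensorProduct.smul_tmul]
end

section
/- Let V be a ℚ-vector space equipped with ℚ-bilinear products ∘ₙ : V × V → V for each n ∈ ℕ. Then the identity (a ∘ₙ b) ∘ₘ c = Σ_{s=0}^{n} (−1)^s (n choose s) · a ∘_{n−s} (b ∘_{m+s} c) holds for all a, b, c ∈ V and all n, m ∈ ℕ if and only if the identity a ∘ₙ (b ∘ₘ c) = Σ_{s=0}^{n} (n choose s) · (a ∘_{n−s} b) ∘_{m+s} c holds for all a, b, c ∈ V and all n, m ∈ ℕ. -/
open Finset in
/-- The binomial transform of a double sequence `F`, moving weight from the first index to the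
second one, with parameter `r`. -/
def shiftedBinomialTransform {V : Type*} [AddCommGroup V] [Module ℚ V] (r : ℚ)
    (F : ℕ → ℕ → V) (n m : ℕ) : V :=
  ∑ ij ∈ antidiagonal n, n.choose ij.1 • r ^ ij.1 • F ij.2 (m + ij.1)

namespace shiftedBinomialTransform

variable {V : Type*} [AddCommGroup V] [Module ℚ V]

theorem eq_sum_range (r : ℚ) (F : ℕ → ℕ → V) (n m : ℕ) :
    shiftedBinomialTransform r F n m =
      ∑ s ∈ Finset.range (n + 1), (r ^ s * (n.choose s : ℚ)) • F (n - s) (m + s) := by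
  rw [shiftedBinomialTransform,
    Finset.Nat.sum_antidiagonal_eq_sum_range_succ
      (fun i j ↦ n.choose i • r ^ i • F j (m + i))]
  refine Finset.sum_congr rfl fun s _ ↦ ?_
  rw [← Nat.cast_smul_eq_nsmul ℚ, smul_smul, mul_comm]

/-- Pascal's rule for the transform. -/
theorem succ_left (r : ℚ) (F : ℕ → ℕ → V) (n m : ℕ) :
    shiftedBinomialTransform r F (n + 1) m =
      shiftedBinomialTransform r (fun k l ↦ F (k + 1) l) n m +
        r • shiftedBinomialTransform r F n (m + 1) := by
  simp only [shiftedBinomialTransform]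
  rw [Finset.sum_antidiagonal_choose_succ_nsmul (fun i j ↦ r ^ i • F j (m + i)),
    Finset.smul_sum]
  congr 1
  refine Finset.sum_congr rfl fun ij h ↦ ?_
  have hn : n = ij.1 + ij.2 := (Finset.HasAntidiagonal.mem_antidiagonal.mp h).symm
  rw [← Nat.choose_symm_of_eq_add hn, smul_comm r, smul_smul r,
    pow_succ', add_right_comm, add_assoc]

theorem add_smul (r t : ℚ) (F G : ℕ → ℕ → V) (n m : ℕ) :
    shiftedBinomialTransform r (fun k l ↦ F k l + t • G k (l + 1)) n m =
      shiftedBinomialTransform r F n m + t • shiftedBinomialTransform r G n (m + 1) := by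
  simp only [shiftedBinomialTransform, Finset.smul_sum, ← Finset.sum_add_distrib]
  refine Finset.sum_congr rfl fun ij _ ↦ ?_
  rw [smul_add, smul_add, smul_comm t, smul_comm t, add_right_comm]

/-- The transforms with opposite parameters are mutually inverse. -/
theorem apply_neg (r : ℚ) (F : ℕ → ℕ → V) (n m : ℕ) :
    shiftedBinomialTransform r (shiftedBinomialTransform (-r) F) n m = F n m := by
  induction n generalizing F m with
  | zero => simp [shiftedBinomialTransform]
  | succ n ih =>
    simp only [succ_left r, succ_left (-r), add_smul, ih]
    module

theorem eq_iff (r : ℚ) (F G : ℕ → ℕ → V) :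
    (∀ n m, F n m = shiftedBinomialTransform (-r) G n m) ↔
      ∀ n m, G n m = shiftedBinomialTransform r F n m := by
  constructor <;> intro h n m
  · rw [funext₂ h, apply_neg]
  · rw [funext₂ h]
    simpa only [neg_neg] using (apply_neg (-r) F n m).symm

end shiftedBinomialTransform


theorem conformal_associativity_equiv
    (V : Type*) [AddCommGroup V] [Module ℚ V]
    (mul : ℕ → V →ₗ[ℚ] V →ₗ[ℚ] V) :
    (∀ (a b c : V) (n m : ℕ),
        mul m (mul n a b) c =
          ∑ s ∈ Finset.range (n + 1),
            ((-1 : ℚ) ^ s * (n.choose s : ℚ)) • mul (n - s) a (mul (m + s) b c)) ↔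
    (∀ (a b c : V) (n m : ℕ),
        mul n a (mul m b c) =
          ∑ s ∈ Finset.range (n + 1),
            ((n.choose s : ℚ)) • mul (m + s) (mul (n - s) a b) c) := by
  refine forall_congr' fun a ↦ forall_congr' fun b ↦ forall_congr' fun c ↦ ?_
  simpa only [shiftedBinomialTransform.eq_sum_range, one_pow, one_mul] using
    shiftedBinomialTransform.eq_iff 1 (fun n m ↦ mul m (mul n a b) c)
      (fun n m ↦ mul n a (mul m b c))
end

section
/- Let C be an associative conformal algebra over ℚ, B ⊆ C a subset, and N : B × B → ℕ a function such that a ∘ₘ b = 0 for all a, b ∈ B and all m ≥ N(a,b). Then for every a₀ ∈ B, every n ∈ ℕ, every b ∈ B and every D-free normal word w ∈ W_b, the element a₀ ∘ₙ w lies in the ℚ-linear span of W_{a₀}, the set of D-free normal words starting with a₀. -/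
/-- D-free normal words starting with a given element of `B`, relative to a family of
products `mul`, a set of generators `B` and a locality function `N`:
`a ∈ W_a` for `a ∈ B`; and if `b ∈ B`, `w ∈ W_b` and `m < N a b`, then `a ∘ₘ w ∈ W_a`. -/
inductive IsNormalWord {C : Type*} (mul : ℕ → C → C → C) (B : Set C) (N : C → C → ℕ) :
    C → C → Prop
  | base (a : C) (ha : a ∈ B) : IsNormalWord mul B N a a
  | step (a b w : C) (ha : a ∈ B) (hb : b ∈ B) (hw : IsNormalWord mul B N b w)
      (m : ℕ) (hm : m < N a b) : IsNormalWord mul B N a (mul m a w)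

/-- Normal words starting with a given element, graded by the number of products used. -/
inductive IsNormalWordOfLength {C : Type*} (mul : ℕ → C → C → C) (B : Set C) (N : C → C → ℕ) :
    ℕ → C → C → Prop
  | base (a : C) (ha : a ∈ B) : IsNormalWordOfLength mul B N 0 a a
  | step (L : ℕ) (a b w : C) (ha : a ∈ B) (hb : b ∈ B) (hw : IsNormalWordOfLength mul B N L b w)
      (m : ℕ) (hm : m < N a b) : IsNormalWordOfLength mul B N (L + 1) a (mul m a w)

theorem IsNormalWordOfLength.isNormalWord {C : Type*} {mul : ℕ → C → C → C} {B : Set C}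
    {N : C → C → ℕ} {L : ℕ} {a w : C} (h : IsNormalWordOfLength mul B N L a w) :
    IsNormalWord mul B N a w := by
  induction h with
  | base a ha => exact .base a ha
  | step L a b w ha hb _ m hm ih => exact .step a b w ha hb ih m hm

theorem IsNormalWord.exists_length {C : Type*} {mul : ℕ → C → C → C} {B : Set C}
    {N : C → C → ℕ} {a w : C} (h : IsNormalWord mul B N a w) :
    ∃ L, IsNormalWordOfLength mul B N L a w := by
  induction h with
  | base a ha => exact ⟨0, .base a ha⟩
  | step a b w ha hb _ m hm ih =>
    obtain ⟨L, hL⟩ := ih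
    exact ⟨L + 1, .step L a b w ha hb hL m hm⟩

/-- Left multiplication by a generator raises the length of normal words by one, up to taking
linear combinations. -/
theorem mul_mem_span_isNormalWordOfLength
    {C : Type*} [AddCommGroup C] [Module ℚ C] (mul : ℕ → C →ₗ[ℚ] C →ₗ[ℚ] C)
    (hassoc : ∀ (a b c : C) (n m : ℕ),
      mul m (mul n a b) c =
        ∑ s ∈ Finset.range (n + 1),
          ((-1 : ℚ) ^ s * (n.choose s : ℚ)) • mul (n - s) a (mul (m + s) b c))
    (B : Set C) (N : C → C → ℕ)
    (hN : ∀ a ∈ B, ∀ b ∈ B, ∀ m ≥ N a b, mul m a b = 0) (L : ℕ) :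
    ∀ (n : ℕ), ∀ a ∈ B, ∀ b ∈ B, ∀ w : C,
      IsNormalWordOfLength (fun k x y => mul k x y) B N L b w →
      mul n a w ∈ Submodule.span ℚ
        {x : C | IsNormalWordOfLength (fun k x y => mul k x y) B N (L + 1) a x} := by
  induction L with
  | zero =>
    intro n a ha b hb w hw
    by_cases hn : n < N a b
    · exact Submodule.subset_span (IsNormalWordOfLength.step 0 a b w ha hb hw n hn)
    · cases hw
      rw [hN a ha b hb n (not_lt.mp hn)]
      exact Submodule.zero_mem _
  | succ L ihL =>
    intro n
    induction n using Nat.strong_induction_on with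
    | _ n ihn =>
      intro a ha b hb w hw
      by_cases hn : n < N a b
      · exact Submodule.subset_span
          (IsNormalWordOfLength.step (L + 1) a b w ha hb hw n hn)
      · cases hw with
        | step _ _ c v _ hc hv m hm =>
          have key := hassoc a b v n m
          rw [hN a ha b hb n (not_lt.mp hn), Finset.sum_range_succ'] at key
          simp only [map_zero, LinearMap.zero_apply, pow_zero, Nat.choose_zero_right,
            Nat.cast_one, mul_one, one_smul, Nat.sub_zero, add_zero] at key
          change mul n a (mul m b v) ∈ _
          rw [eq_neg_of_add_eq_zero_right key.symm]
          refine Submodule.neg_mem _ (Submodule.sum_mem _ fun s hs => Submodule.smul_mem _ _ ?_)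
          have hs' : n - (s + 1) < n := by
            have := Finset.mem_range.mp hs
            omega
          have hspan := ihL (m + (s + 1)) b hb c hc v hv
          exact Submodule.mem_comap.mp
            (Submodule.span_le.mpr (fun x hx => ihn _ hs' a ha b hb x hx) hspan)

theorem normal_word_span
    (C : Type*) [AddCommGroup C] [Module ℚ C]
    (D : C →ₗ[ℚ] C) (mul : ℕ → C →ₗ[ℚ] C →ₗ[ℚ] C)
    -- locality
    (hloc : ∀ a b : C, ∃ N : ℕ, ∀ n ≥ N, mul n a b = 0)
    -- sesquilinearity
    (hsesq₁ : ∀ (a b : C) (n : ℕ), mul n (D a) b = -(n : ℚ) • mul (n - 1) a b)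
    (hsesq₂ : ∀ (a b : C) (n : ℕ), mul n a (D b) = D (mul n a b) + (n : ℚ) • mul (n - 1) a b)
    -- associativity
    (hassoc : ∀ (a b c : C) (n m : ℕ),
      mul m (mul n a b) c =
        ∑ s ∈ Finset.range (n + 1),
          ((-1 : ℚ) ^ s * (n.choose s : ℚ)) • mul (n - s) a (mul (m + s) b c))
    (B : Set C) (N : C → C → ℕ)
    (hN : ∀ a ∈ B, ∀ b ∈ B, ∀ m ≥ N a b, mul m a b = 0) :
    ∀ a₀ ∈ B, ∀ (n : ℕ), ∀ b ∈ B, ∀ w : C,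
      IsNormalWord (fun k x y => mul k x y) B N b w →
      mul n a₀ w ∈
        Submodule.span ℚ {x : C | IsNormalWord (fun k x y => mul k x y) B N a₀ x} := by
  intro a ha n b hb w hw
  obtain ⟨L, hL⟩ := hw.exists_length
  exact Submodule.span_mono (fun x hx => IsNormalWordOfLength.isNormalWord hx)
    (mul_mem_span_isNormalWordOfLength mul hassoc B N hN L n a ha b hb w hL)
end

section
/- Let C be an associative conformal algebra over ℚ, B ⊆ C a subset, and N : B × B → ℕ a function such that a ∘ₘ b = 0 for all a, b ∈ B and all m ≥ N(a,b). Assume C is generated by B as a conformal algebra: the only ℚ-subspace of C that contains B and is closed under D and under all products ∘ₙ is C itself. Then C equals the ℚ-linear span of the set of elements D^s(w) with s ∈ ℕ and w ∈ ⋃_{a ∈ B} W_a; that is, every element of C is a ℚ-linear combination of normal words. -/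
/-- The normal words starting with `a` that are built from exactly `n + 1` generators. -/
def normalWordsOfLength {C : Type*} (mul : ℕ → C → C → C) (B : Set C) (N : C → C → ℕ) :
    ℕ → C → Set C
  | 0, a => {w | w = a}
  | n + 1, a => {y | ∃ b ∈ B, ∃ w ∈ normalWordsOfLength mul B N n b, ∃ m < N a b, y = mul m a w}

theorem isNormalWord_of_mem_normalWordsOfLength {C : Type*} {mul : ℕ → C → C → C} {B : Set C}
    {N : C → C → ℕ} {n : ℕ} {a w : C} (ha : a ∈ B) (hw : w ∈ normalWordsOfLength mul B N n a) :
    IsNormalWord mul B N a w := by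
  induction n generalizing a w with
  | zero =>
    obtain rfl : w = a := hw
    exact .base w ha
  | succ n ih =>
    obtain ⟨b, hb, u, hu, m, hm, rfl⟩ := hw
    exact .step a b u ha hb (ih hb hu) m hm

theorem IsNormalWord.exists_mem_normalWordsOfLength {C : Type*} {mul : ℕ → C → C → C} {B : Set C}
    {N : C → C → ℕ} {a w : C} (hw : IsNormalWord mul B N a w) :
    ∃ n, w ∈ normalWordsOfLength mul B N n a := by
  induction hw with
  | base a ha => exact ⟨0, rfl⟩
  | step a b w ha hb hw m hm ih =>
    obtain ⟨n, hn⟩ := ih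
    exact ⟨n + 1, b, hb, w, hn, m, hm, rfl⟩

/-- Left multiplication by a generator maps the span of the normal words of a given length into
the span of the normal words that are one generator longer. -/
theorem mul_mem_span_normalWordsOfLength {C : Type*} [AddCommGroup C] [Module ℚ C]
    (mul : ℕ → C →ₗ[ℚ] C →ₗ[ℚ] C)
    (hassoc : ∀ (a b c : C) (n m : ℕ),
      mul m (mul n a b) c =
        ∑ s ∈ Finset.range (n + 1),
          ((-1 : ℚ) ^ s * (n.choose s : ℚ)) • mul (n - s) a (mul (m + s) b c))
    (B : Set C) (N : C → C → ℕ)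
    (hN : ∀ a ∈ B, ∀ b ∈ B, ∀ m ≥ N a b, mul m a b = 0)
    (n m : ℕ) {a x : C} (ha : a ∈ B)
    (hx : x ∈ Submodule.span ℚ
      (⋃ b ∈ B, normalWordsOfLength (fun k x y => mul k x y) B N n b)) :
    mul m a x ∈ Submodule.span ℚ
      (⋃ b ∈ B, normalWordsOfLength (fun k x y => mul k x y) B N (n + 1) b) := by
  induction n generalizing m a x with
  | zero =>
    induction hx using Submodule.span_induction with
    | mem x hx =>
      obtain ⟨b, hb, hxb⟩ := Set.mem_iUnion₂.1 hx
      obtain rfl : x = b := hxb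
      by_cases hm : m < N a x
      · exact Submodule.subset_span (Set.mem_iUnion₂.2 ⟨a, ha, x, hb, x, rfl, m, hm, rfl⟩)
      · rw [hN a ha x hb m (not_lt.1 hm)]
        exact Submodule.zero_mem _
    | zero => simp
    | add x y _ _ ihx ihy => rw [map_add]; exact Submodule.add_mem _ ihx ihy
    | smul c x _ ihx => rw [map_smul]; exact Submodule.smul_mem _ c ihx
  | succ n ih =>
    induction m using Nat.strong_induction_on generalizing x with
    | _ m ihm =>
    induction hx using Submodule.span_induction with
    | mem x hx =>
      obtain ⟨b, hb, hxb⟩ := Set.mem_iUnion₂.1 hx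
      by_cases hm : m < N a b
      · exact Submodule.subset_span (Set.mem_iUnion₂.2 ⟨a, ha, b, hb, x, hxb, m, hm, rfl⟩)
      · obtain ⟨c, hc, u, hu, p, -, rfl⟩ := hxb
        have h := hassoc a b u m p
        rw [hN a ha b hb m (not_lt.1 hm), Finset.sum_range_succ'] at h
        simp only [map_zero, LinearMap.zero_apply, pow_zero, Nat.choose_zero_right, Nat.cast_one,
          mul_one, one_smul, Nat.sub_zero, add_zero] at h
        rw [eq_neg_of_add_eq_zero_right h.symm]
        refine Submodule.neg_mem _ (Submodule.sum_mem _ fun s hs => Submodule.smul_mem _ _ ?_)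
        have hsm := Finset.mem_range.1 hs
        exact ihm _ (by omega)
          (ih _ hb (Submodule.subset_span (Set.mem_iUnion₂.2 ⟨c, hc, hu⟩)))
    | zero => simp
    | add x y _ _ ihx ihy => rw [map_add]; exact Submodule.add_mem _ ihx ihy
    | smul c x _ ihx => rw [map_smul]; exact Submodule.smul_mem _ c ihx

theorem span_of_normal_words_eq_top
    (C : Type*) [AddCommGroup C] [Module ℚ C]
    (D : C →ₗ[ℚ] C) (mul : ℕ → C →ₗ[ℚ] C →ₗ[ℚ] C)
    -- locality
    (hloc : ∀ a b : C, ∃ N : ℕ, ∀ n ≥ N, mul n a b = 0)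
    -- sesquilinearity
    (hsesq₁ : ∀ (a b : C) (n : ℕ), mul n (D a) b = -(n : ℚ) • mul (n - 1) a b)
    (hsesq₂ : ∀ (a b : C) (n : ℕ), mul n a (D b) = D (mul n a b) + (n : ℚ) • mul (n - 1) a b)
    -- associativity
    (hassoc : ∀ (a b c : C) (n m : ℕ),
      mul m (mul n a b) c =
        ∑ s ∈ Finset.range (n + 1),
          ((-1 : ℚ) ^ s * (n.choose s : ℚ)) • mul (n - s) a (mul (m + s) b c))
    (B : Set C) (N : C → C → ℕ)
    (hN : ∀ a ∈ B, ∀ b ∈ B, ∀ m ≥ N a b, mul m a b = 0)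
    -- `C` is generated by `B` as a conformal algebra
    (hgen : ∀ S : Submodule ℚ C, B ⊆ S → (∀ x ∈ S, D x ∈ S) →
      (∀ (n : ℕ), ∀ x ∈ S, ∀ y ∈ S, mul n x y ∈ S) → ∀ x : C, x ∈ S) :
    ∀ x : C, x ∈ Submodule.span ℚ
      {y : C | ∃ (s : ℕ) (a w : C), a ∈ B ∧
        IsNormalWord (fun k x y => mul k x y) B N a w ∧ y = (⇑D)^[s] w} := by
  set V := Submodule.span ℚ {y : C | ∃ (s : ℕ) (a w : C), a ∈ B ∧
        IsNormalWord (fun k x y => mul k x y) B N a w ∧ y = (⇑D)^[s] w}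
  have hD : ∀ x ∈ V, D x ∈ V := by
    intro x hx
    induction hx using Submodule.span_induction with
    | mem x hx =>
      obtain ⟨s, a, w, ha, hw, rfl⟩ := hx
      exact Submodule.subset_span ⟨s + 1, a, w, ha, hw, (Function.iterate_succ_apply' _ _ _).symm⟩
    | zero => simp
    | add x y _ _ ihx ihy => rw [map_add]; exact V.add_mem ihx ihy
    | smul c x _ ihx => rw [map_smul]; exact V.smul_mem c ihx
  have hgenerator : ∀ a ∈ B, ∀ x ∈ V, ∀ m, mul m a x ∈ V := by
    intro a ha x hx
    induction hx using Submodule.span_induction with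
    | mem x hx =>
      obtain ⟨s, b, w, hb, hw, rfl⟩ := hx
      induction s with
      | zero =>
        intro m
        obtain ⟨n, hn⟩ := hw.exists_mem_normalWordsOfLength
        refine Submodule.span_mono ?_ (mul_mem_span_normalWordsOfLength mul hassoc B N hN n m ha
          (Submodule.subset_span (Set.mem_iUnion₂.2 ⟨b, hb, hn⟩)))
        intro y hy
        obtain ⟨c, hc, hyc⟩ := Set.mem_iUnion₂.1 hy
        exact ⟨0, c, y, hc, isNormalWord_of_mem_normalWordsOfLength hc hyc, rfl⟩
      | succ s ih =>
        intro m
        rw [Function.iterate_succ_apply', hsesq₂]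
        exact V.add_mem (hD _ (ih m)) (V.smul_mem _ (ih _))
    | zero => simp
    | add x y _ _ ihx ihy => intro m; rw [map_add]; exact V.add_mem (ihx m) (ihy m)
    | smul c x _ ihx => intro m; rw [map_smul]; exact V.smul_mem c (ihx m)
  have hword : ∀ a w, IsNormalWord (fun k x y => mul k x y) B N a w →
      ∀ y ∈ V, ∀ m, mul m w y ∈ V := by
    intro a w hw
    induction hw with
    | base a ha => exact hgenerator a ha
    | step a b w ha hb hw n hn ih =>
      intro y hy m
      rw [hassoc]
      exact V.sum_mem fun s _ => V.smul_mem _ (hgenerator a ha _ (ih y hy _) _)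
  refine hgen V (fun a ha => Submodule.subset_span ⟨0, a, a, ha, .base a ha, rfl⟩) hD ?_
  intro n x hx y hy
  induction hx using Submodule.span_induction generalizing n with
  | mem x hx =>
    obtain ⟨s, a, w, ha, hw, rfl⟩ := hx
    induction s generalizing n with
    | zero => exact hword a w hw y hy n
    | succ s ih =>
      rw [Function.iterate_succ_apply', hsesq₁]
      exact V.smul_mem _ (ih _)
  | zero => simp
  | add x z _ _ ihx ihz => rw [map_add, LinearMap.add_apply]; exact V.add_mem (ihx n) (ihz n)
  | smul c x _ ihx => rw [map_smul, LinearMap.smul_apply]; exact V.smul_mem c (ihx n)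
end

section
/- There exists exactly one family of ℚ-bilinear maps ∘ₙ : A[X] × A[X] → A[X] (n ∈ ℕ) satisfying, for all p, q ∈ A[X], all a, b ∈ A and all n ∈ ℕ: (X·p) ∘ₙ q = −n·(p ∘_{n−1} q) (interpreted as 0 when n = 0); p ∘ₙ (X·q) = X·(p ∘ₙ q) + n·(p ∘_{n−1} q); and (C a) ∘ₙ (C b) = (−1)ⁿ · C(a·∂ⁿ(b)). Moreover, this family satisfies locality (for all p, q ∈ A[X] there is N with p ∘ₙ q = 0 for all n ≥ N) and conformal associativity: (p ∘ₙ q) ∘ₘ r = Σ_{s=0}^{n} (−1)^s (n choose s) · p ∘_{n−s} (q ∘_{m+s} r) for all p, q, r ∈ A[X] and n, m ∈ ℕ. -/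
open Polynomial

section AlternatingSum

variable {M : Type*} [AddCommGroup M] [Module ℚ M]

/-- The alternating binomial sum `∑ (-1)^s * (n choose s) • F (n - s) s`. -/
def alternatingSum (n : ℕ) (F : ℕ → ℕ → M) : M :=
  ∑ s ∈ Finset.range (n + 1), ((-1 : ℚ) ^ s * (n.choose s : ℚ)) • F (n - s) s

theorem alternatingSum_congr {n : ℕ} {F G : ℕ → ℕ → M} (h : ∀ i j, F i j = G i j) :
    alternatingSum n F = alternatingSum n G := by
  simp only [alternatingSum, h]

theorem alternatingSum_add (n : ℕ) (F G : ℕ → ℕ → M) :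
    alternatingSum n (fun i j => F i j + G i j) = alternatingSum n F + alternatingSum n G := by
  simp only [alternatingSum, smul_add, Finset.sum_add_distrib]

theorem map_alternatingSum {N : Type*} [AddCommGroup N] [Module ℚ N] (f : M →ₗ[ℚ] N) (n : ℕ)
    (F : ℕ → ℕ → M) : alternatingSum n (fun i j => f (F i j)) = f (alternatingSum n F) := by
  simp only [alternatingSum, map_sum, map_smul]

theorem alternatingSum_smul (n : ℕ) (c : ℚ) (F : ℕ → ℕ → M) :
    alternatingSum n (fun i j => c • F i j) = c • alternatingSum n F :=
  map_alternatingSum (c • LinearMap.id) n F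

/-- Pascal's rule for alternating binomial sums. -/
theorem alternatingSum_succ (n : ℕ) (F : ℕ → ℕ → M) :
    alternatingSum (n + 1) F =
      alternatingSum n (fun i j => F (i + 1) j - F i (j + 1)) := by
  unfold alternatingSum
  simp only [smul_sub, Finset.sum_sub_distrib]
  rw [Finset.sum_range_succ' _ (n + 1)]
  have h (s : ℕ) : ((-1 : ℚ) ^ (s + 1) * ((n + 1).choose (s + 1) : ℚ)) •
      F (n + 1 - (s + 1)) (s + 1) =
      ((-1 : ℚ) ^ (s + 1) * (n.choose (s + 1) : ℚ)) • F (n - s) (s + 1) -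
      ((-1 : ℚ) ^ s * (n.choose s : ℚ)) • F (n - s) (s + 1) := by
    rw [Nat.add_sub_add_right, ← sub_smul, Nat.choose_succ_succ']
    push_cast
    ring_nf
  simp only [h, Finset.sum_sub_distrib]
  rw [Finset.sum_range_succ, Finset.sum_range_succ' (fun s => _ • F (n - s + 1) s)]
  have h' : ∀ s ∈ Finset.range n,
      ((-1 : ℚ) ^ (s + 1) * (n.choose (s + 1) : ℚ)) • F (n - s) (s + 1) =
      ((-1 : ℚ) ^ (s + 1) * (n.choose (s + 1) : ℚ)) • F (n - (s + 1) + 1) (s + 1) := by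
    intro s hs
    rw [Finset.mem_range] at hs
    rw [show n - (s + 1) + 1 = n - s by omega]
  rw [Finset.sum_congr rfl h']
  simp
  abel

theorem alternatingSum_fst_smul (n : ℕ) (F : ℕ → ℕ → M) :
    alternatingSum n (fun i j => (i : ℚ) • F (i - 1) j) =
      (n : ℚ) • alternatingSum (n - 1) F := by
  cases n with
  | zero => simp [alternatingSum]
  | succ n =>
    simp only [alternatingSum, Nat.add_sub_cancel]
    rw [Finset.sum_range_succ, Finset.smul_sum]
    simp only [Nat.sub_self, Nat.cast_zero, zero_smul, smul_zero, add_zero]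
    refine Finset.sum_congr rfl fun s hs => ?_
    rw [Finset.mem_range] at hs
    have h : (n.choose s : ℚ) * (n + 1 : ℕ) = ((n + 1).choose s : ℚ) * (n + 1 - s : ℕ) :=
      mod_cast Nat.choose_mul_succ_eq n s
    rw [smul_smul, smul_smul, mul_assoc, ← h, show n + 1 - s - 1 = n - s by omega]
    ring_nf

theorem alternatingSum_snd_smul (n : ℕ) (F : ℕ → ℕ → M) :
    alternatingSum n (fun i j => (j : ℚ) • F i (j - 1)) =
      -(n : ℚ) • alternatingSum (n - 1) F := by
  cases n with
  | zero => simp [alternatingSum]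
  | succ n =>
    simp only [alternatingSum, Nat.add_sub_cancel]
    rw [Finset.sum_range_succ', Finset.smul_sum]
    simp only [Nat.cast_zero, zero_smul, smul_zero, add_zero]
    refine Finset.sum_congr rfl fun s _ => ?_
    have h : ((n + 1 : ℕ) : ℚ) * (n.choose s : ℚ) =
        ((n + 1).choose (s + 1) : ℚ) * (s + 1 : ℕ) :=
      mod_cast Nat.add_one_mul_choose_eq n s
    rw [smul_smul, smul_smul, mul_assoc, ← h, Nat.add_sub_add_right, Nat.add_sub_cancel]
    ring_nf

theorem alternatingSum_add_smul (n m : ℕ) (F : ℕ → ℕ → M) :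
    alternatingSum n (fun i j => ((m + j : ℕ) : ℚ) • F i (m + j - 1)) =
      (m : ℚ) • alternatingSum n (fun i j => F i (m - 1 + j)) -
        (n : ℚ) • alternatingSum (n - 1) (fun i j => F i (m + j)) := by
  have h (i j : ℕ) : ((m + j : ℕ) : ℚ) • F i (m + j - 1) =
      (m : ℚ) • F i (m - 1 + j) + (j : ℚ) • F i (m + (j - 1)) := by
    rcases m with - | m
    · simp
    rcases j with - | j
    · simp
    rw [show m + 1 + (j + 1) - 1 = m + 1 - 1 + (j + 1) by omega,
      show m + 1 + (j + 1 - 1) = m + 1 - 1 + (j + 1) by omega, ← add_smul, Nat.cast_add]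
  rw [alternatingSum_congr h, alternatingSum_add, alternatingSum_smul,
    alternatingSum_snd_smul n (fun i j => F i (m + j)), neg_smul, sub_eq_add_neg]

end AlternatingSum

theorem alternatingSum_iterate_derivation {A : Type*} [Ring A] [Algebra ℚ A] (d : A →ₗ[ℚ] A)
    (hder : ∀ x y : A, d (x * y) = d x * y + x * d y) (n : ℕ) (b y : A) :
    alternatingSum n (fun i j => d^[i] (b * d^[j] y)) = d^[n] b * y := by
  induction n generalizing b with
  | zero => simp [alternatingSum]
  | succ n ih =>
    rw [alternatingSum_succ, Function.iterate_succ_apply, ← ih]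
    refine alternatingSum_congr fun i j => ?_
    rw [Function.iterate_succ_apply, hder, iterate_map_add, Function.iterate_succ_apply',
      add_sub_cancel_right]

theorem Polynomial.induction_C_add_X_mul {A : Type*} [Semiring A] {P : A[X] → Prop} (p : A[X])
    (hC : ∀ a, P (C a)) (hadd : ∀ p q, P p → P q → P (p + q)) (hX : ∀ p, P p → P (X * p)) :
    P p := by
  induction p using Polynomial.induction_on' with
  | add p q hp hq => exact hadd p q hp hq
  | monomial k a =>
    induction k with
    | zero => exact hC a
    | succ k ih => simpa only [X_mul_monomial] using hX _ ih

section ConformalProduct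

variable {A : Type*} [Ring A] [Algebra ℚ A]

/-- The sesquilinearity axioms for a family of products, together with their values on
constants. -/
structure IsConformalExtension (d : A →ₗ[ℚ] A) (mul : ℕ → A[X] →ₗ[ℚ] A[X] →ₗ[ℚ] A[X]) :
    Prop where
  X_mul_left : ∀ (p q : A[X]) (n : ℕ), mul n (X * p) q = -(n : ℚ) • mul (n - 1) p q
  X_mul_right : ∀ (p q : A[X]) (n : ℕ),
    mul n p (X * q) = X * mul n p q + (n : ℚ) • mul (n - 1) p q
  C_C : ∀ (a b : A) (n : ℕ), mul n (C a) (C b) = ((-1 : ℚ) ^ n) • C (a * (⇑d)^[n] b)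

namespace IsConformalExtension

variable {d : A →ₗ[ℚ] A} {mul mul' : ℕ → A[X] →ₗ[ℚ] A[X] →ₗ[ℚ] A[X]}

theorem unique (h : IsConformalExtension d mul) (h' : IsConformalExtension d mul') :
    mul = mul' := by
  have key (p : A[X]) : ∀ q n, mul n p q = mul' n p q := by
    induction p using Polynomial.induction_C_add_X_mul with
    | hadd p₁ p₂ h₁ h₂ => intro q n; simp [h₁, h₂]
    | hX p hp => intro q n; rw [h.X_mul_left, h'.X_mul_left, hp]
    | hC a =>
      intro q
      induction q using Polynomial.induction_C_add_X_mul with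
      | hadd q₁ q₂ h₁ h₂ => intro n; simp [h₁, h₂]
      | hX q hq => intro n; rw [h.X_mul_right, h'.X_mul_right, hq, hq]
      | hC b => intro n; rw [h.C_C, h'.C_C]
  ext1 n
  exact LinearMap.ext₂ fun p q => key p q n

theorem locality (h : IsConformalExtension d mul) (hnil : ∀ a : A, ∃ N : ℕ, d^[N] a = 0)
    (p q : A[X]) : ∃ N : ℕ, ∀ n ≥ N, mul n p q = 0 := by
  induction p using Polynomial.induction_C_add_X_mul with
  | hadd p₁ p₂ h₁ h₂ =>
    obtain ⟨N₁, h₁⟩ := h₁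
    obtain ⟨N₂, h₂⟩ := h₂
    refine ⟨max N₁ N₂, fun n hn => ?_⟩
    rw [map_add, LinearMap.add_apply, h₁ n (le_of_max_le_left hn),
      h₂ n (le_of_max_le_right hn), add_zero]
  | hX p hp =>
    obtain ⟨N, hN⟩ := hp
    exact ⟨N + 1, fun n hn => by rw [h.X_mul_left, hN (n - 1) (by omega), smul_zero]⟩
  | hC a =>
    induction q using Polynomial.induction_C_add_X_mul with
    | hadd q₁ q₂ h₁ h₂ =>
      obtain ⟨N₁, h₁⟩ := h₁
      obtain ⟨N₂, h₂⟩ := h₂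
      refine ⟨max N₁ N₂, fun n hn => ?_⟩
      rw [map_add, h₁ n (le_of_max_le_left hn), h₂ n (le_of_max_le_right hn), add_zero]
    | hX q hq =>
      obtain ⟨N, hN⟩ := hq
      refine ⟨N + 1, fun n hn => ?_⟩
      rw [h.X_mul_right, hN n (by omega), hN (n - 1) (by omega), mul_zero, smul_zero, add_zero]
    | hC b =>
      obtain ⟨N, hN⟩ := hnil b
      refine ⟨N, fun n hn => ?_⟩
      rw [h.C_C, ← Nat.sub_add_cancel hn, Function.iterate_add_apply, hN, iterate_map_zero,
        mul_zero, C_0, smul_zero]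

theorem assoc_C (h : IsConformalExtension d mul)
    (hder : ∀ x y : A, d (x * y) = d x * y + x * d y) (a b c : A) (n m : ℕ) :
    mul m (mul n (C a) (C b)) (C c) =
      alternatingSum n (fun i j => mul i (C a) (mul (m + j) (C b) (C c))) := by
  let f : A →ₗ[ℚ] A[X] := (CAlgHom (R := ℚ)).toLinearMap ∘ₗ LinearMap.mulLeft ℚ a
  have hf (x : A) : f x = C (a * x) := rfl
  have hterm : ∀ s ∈ Finset.range (n + 1),
      ((-1 : ℚ) ^ s * (n.choose s : ℚ)) •
        mul (n - s) (C a) (mul (m + s) (C b) (C c)) =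
      ((-1 : ℚ) ^ s * (n.choose s : ℚ)) •
        ((-1 : ℚ) ^ (n + m) • f (d^[n - s] (b * d^[s] (d^[m] c)))) := by
    intro s hs
    rw [Finset.mem_range] at hs
    rw [h.C_C, map_smul, h.C_C, hf, smul_smul ((-1 : ℚ) ^ (m + s)), ← pow_add,
      show m + s + (n - s) = n + m by omega, add_comm m s, Function.iterate_add_apply]
  rw [alternatingSum, Finset.sum_congr rfl hterm]
  change _ = alternatingSum n
    (fun i j => (-1 : ℚ) ^ (n + m) • f (d^[i] (b * d^[j] (d^[m] c))))
  rw [alternatingSum_smul, map_alternatingSum, alternatingSum_iterate_derivation d hder, hf,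
    h.C_C, map_smul, LinearMap.smul_apply, h.C_C, smul_smul, ← pow_add, mul_assoc]

theorem assoc (h : IsConformalExtension d mul)
    (hder : ∀ x y : A, d (x * y) = d x * y + x * d y) (p q r : A[X]) (n m : ℕ) :
    mul m (mul n p q) r = alternatingSum n (fun i j => mul i p (mul (m + j) q r)) := by
  induction p using Polynomial.induction_C_add_X_mul generalizing n m with
  | hadd p₁ p₂ h₁ h₂ => simp [h₁, h₂, alternatingSum_add]
  | hX p hp =>
    have hterm (i j : ℕ) : mul i (X * p) (mul (m + j) q r) =
        (-1 : ℚ) • ((i : ℚ) • mul (i - 1) p (mul (m + j) q r)) := by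
      rw [h.X_mul_left, neg_smul, neg_one_smul]
    rw [alternatingSum_congr hterm, alternatingSum_smul,
      alternatingSum_fst_smul n (fun i j => mul i p (mul (m + j) q r)), ← hp, h.X_mul_left,
      map_smul, LinearMap.smul_apply, neg_smul, neg_one_smul]
  | hC a =>
    induction q using Polynomial.induction_C_add_X_mul generalizing n m with
    | hadd q₁ q₂ h₁ h₂ => simp [h₁, h₂, alternatingSum_add]
    | hX q hq =>
      have hterm (i j : ℕ) : mul i (C a) (mul (m + j) (X * q) r) =
          (-1 : ℚ) • (((m + j : ℕ) : ℚ) • mul i (C a) (mul (m + j - 1) q r)) := by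
        rw [h.X_mul_left, map_smul, neg_smul, neg_one_smul]
      rw [alternatingSum_congr hterm, alternatingSum_smul,
        alternatingSum_add_smul n m (fun i j => mul i (C a) (mul j q r)), ← hq, ← hq,
        h.X_mul_right, map_add, LinearMap.add_apply, h.X_mul_left, map_smul,
        LinearMap.smul_apply]
      module
    | hC b =>
      induction r using Polynomial.induction_C_add_X_mul generalizing n m with
      | hadd r₁ r₂ h₁ h₂ => simp [h₁, h₂, alternatingSum_add]
      | hX r hr =>
        have hterm (i j : ℕ) : mul i (C a) (mul (m + j) (C b) (X * r)) =
            (LinearMap.mulLeft ℚ X (mul i (C a) (mul (m + j) (C b) r)) +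
              (i : ℚ) • mul (i - 1) (C a) (mul (m + j) (C b) r)) +
            ((m + j : ℕ) : ℚ) • mul i (C a) (mul (m + j - 1) (C b) r) := by
          rw [h.X_mul_right, map_add, h.X_mul_right, map_smul,
            LinearMap.mulLeft_apply]
        rw [alternatingSum_congr hterm, alternatingSum_add, alternatingSum_add,
          alternatingSum_add_smul n m (fun i j => mul i (C a) (mul j (C b) r)),
          alternatingSum_fst_smul n (fun i j => mul i (C a) (mul (m + j) (C b) r)),
          map_alternatingSum, LinearMap.mulLeft_apply,
          ← hr, ← hr, ← hr, h.X_mul_right]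
        abel
      | hC c => exact h.assoc_C hder a b c n m

end IsConformalExtension

/-- The operator `d/dX - d` on polynomials, where `d` acts on the coefficients. -/
noncomputable def derivativeSubMap (d : A →ₗ[ℚ] A) : A[X] →ₗ[ℚ] A[X] :=
  (derivative (R := A)).restrictScalars ℚ -
    Polynomial.lsum fun k => ((monomial k : A →ₗ[A] A[X]).restrictScalars ℚ) ∘ₗ d

theorem derivativeSubMap_monomial (d : A →ₗ[ℚ] A) (k : ℕ) (a : A) :
    derivativeSubMap d (monomial k a) =
      monomial (k - 1) (a * k) - monomial k (d a) := by
  simp [derivativeSubMap, derivative_monomial, Polynomial.lsum_apply]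

theorem derivativeSubMap_C (d : A →ₗ[ℚ] A) (a : A) :
    derivativeSubMap d (C a) = -C (d a) := by
  simpa using derivativeSubMap_monomial d 0 a

theorem derivativeSubMap_X_mul (d : A →ₗ[ℚ] A) (q : A[X]) :
    derivativeSubMap d (X * q) = X * derivativeSubMap d q + q := by
  induction q using Polynomial.induction_on' with
  | add p q hp hq => rw [mul_add, map_add, map_add, hp, hq]; noncomm_ring
  | monomial k a =>
    rw [X_mul_monomial, derivativeSubMap_monomial, derivativeSubMap_monomial, mul_sub,
      X_mul_monomial, X_mul_monomial]
    rcases k with - | k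
    · simp
      abel
    · simp only [Nat.add_sub_cancel]
      rw [sub_add_eq_add_sub, ← map_add]
      push_cast
      noncomm_ring

theorem derivativeSubMap_pow_C (d : A →ₗ[ℚ] A) (n : ℕ) (a : A) :
    (derivativeSubMap d ^ n) (C a) = ((-1 : ℚ) ^ n) • C (d^[n] a) := by
  induction n with
  | zero => simp
  | succ n ih =>
    rw [pow_succ', Module.End.mul_apply, ih, map_smul, derivativeSubMap_C,
      Function.iterate_succ_apply', pow_succ, mul_neg_one, neg_smul, smul_neg]

theorem derivativeSubMap_pow_X_mul (d : A →ₗ[ℚ] A) (n : ℕ) (q : A[X]) :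
    (derivativeSubMap d ^ n) (X * q) =
      X * (derivativeSubMap d ^ n) q + (n : ℚ) • (derivativeSubMap d ^ (n - 1)) q := by
  induction n with
  | zero => simp
  | succ n ih =>
    rw [pow_succ', Module.End.mul_apply, ih, map_add, map_smul, derivativeSubMap_X_mul,
      Nat.add_sub_cancel, Module.End.mul_apply]
    rcases n with - | n
    · simp
    · simp only [Nat.add_sub_cancel, pow_succ', Module.End.mul_apply]
      push_cast
      module

/-- The conformal products on `A[X]`: on `monomial k a` and `q`, the `n`-th one is
`(-1)^k * n.descFactorial k` times `a * (d/dX - d)^(n - k) q`. -/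
noncomputable def conformalMul (d : A →ₗ[ℚ] A) (n : ℕ) : A[X] →ₗ[ℚ] A[X] →ₗ[ℚ] A[X] :=
  Polynomial.lsum fun k => ((-1 : ℚ) ^ k * (n.descFactorial k : ℚ)) •
    ((LinearMap.mul ℚ A[X]).compl₂ (derivativeSubMap d ^ (n - k)) ∘ₗ
      (CAlgHom (R := ℚ)).toLinearMap)

theorem conformalMul_monomial (d : A →ₗ[ℚ] A) (n k : ℕ) (a : A) (q : A[X]) :
    conformalMul d n (monomial k a) q =
      ((-1 : ℚ) ^ k * (n.descFactorial k : ℚ)) •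
        (C a * (derivativeSubMap d ^ (n - k)) q) := by
  simp [conformalMul, Polynomial.lsum_apply]

theorem isConformalExtension_conformalMul (d : A →ₗ[ℚ] A) :
    IsConformalExtension d (conformalMul d) where
  X_mul_left p q n := by
    induction p using Polynomial.induction_on' with
    | add p₁ p₂ h₁ h₂ => simp only [mul_add, map_add, LinearMap.add_apply, h₁, h₂, smul_add]
    | monomial k a =>
      rw [X_mul_monomial, conformalMul_monomial, conformalMul_monomial, smul_smul]
      rcases n with - | n
      · simp
      · rw [Nat.succ_descFactorial_succ, Nat.add_sub_add_right, Nat.add_sub_cancel]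
        push_cast
        ring_nf
  X_mul_right p q n := by
    induction p using Polynomial.induction_on' with
    | add p₁ p₂ h₁ h₂ =>
      simp only [mul_add, map_add, LinearMap.add_apply, h₁, h₂, smul_add]
      abel
    | monomial k a =>
      have hcoeff : (n.descFactorial k : ℚ) * (n - k : ℕ) =
          n * ((n - 1).descFactorial k : ℚ) := by
        rcases n with - | n
        · simp
        · rw [mul_comm]
          exact mod_cast
            (Nat.descFactorial_succ (n + 1) k).symm.trans (Nat.succ_descFactorial_succ n k)
      rw [conformalMul_monomial, conformalMul_monomial, conformalMul_monomial,
        derivativeSubMap_pow_X_mul, mul_add, smul_add, mul_smul_comm, mul_smul_comm,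
        ← mul_assoc, ← X_mul_C, mul_assoc, smul_smul, smul_smul, mul_assoc, hcoeff,
        Nat.sub_right_comm, mul_left_comm]
  C_C a b n := by
    rw [← monomial_zero_left, conformalMul_monomial, derivativeSubMap_pow_C, pow_zero,
      Nat.descFactorial_zero, Nat.cast_one, one_mul, one_smul, mul_smul_comm, C_mul,
      Nat.sub_zero]

end ConformalProduct

theorem unique_conformal_products_neg_sign
    (A : Type*) [Ring A] [Algebra ℚ A]
    (d : A →ₗ[ℚ] A)
    (hder : ∀ x y : A, d (x * y) = d x * y + x * d y)
    (hnil : ∀ a : A, ∃ N : ℕ, (⇑d)^[N] a = 0) :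
    (∃! mul : ℕ → A[X] →ₗ[ℚ] A[X] →ₗ[ℚ] A[X],
      (∀ (p q : A[X]) (n : ℕ), mul n (X * p) q = -(n : ℚ) • mul (n - 1) p q) ∧
      (∀ (p q : A[X]) (n : ℕ),
        mul n p (X * q) = X * mul n p q + (n : ℚ) • mul (n - 1) p q) ∧
      (∀ (a b : A) (n : ℕ),
        mul n (C a) (C b) = ((-1 : ℚ) ^ n) • C (a * (⇑d)^[n] b))) ∧
    (∀ mul : ℕ → A[X] →ₗ[ℚ] A[X] →ₗ[ℚ] A[X],
      ((∀ (p q : A[X]) (n : ℕ), mul n (X * p) q = -(n : ℚ) • mul (n - 1) p q) ∧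
       (∀ (p q : A[X]) (n : ℕ),
         mul n p (X * q) = X * mul n p q + (n : ℚ) • mul (n - 1) p q) ∧
       (∀ (a b : A) (n : ℕ),
         mul n (C a) (C b) = ((-1 : ℚ) ^ n) • C (a * (⇑d)^[n] b))) →
      -- locality
      (∀ p q : A[X], ∃ N : ℕ, ∀ n ≥ N, mul n p q = 0) ∧
      -- conformal associativity
      (∀ (p q r : A[X]) (n m : ℕ),
        mul m (mul n p q) r =
          ∑ s ∈ Finset.range (n + 1),
            ((-1 : ℚ) ^ s * (n.choose s : ℚ)) • mul (n - s) p (mul (m + s) q r))) := by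
  refine ⟨⟨conformalMul d, ?_, ?_⟩, ?_⟩
  · have h := isConformalExtension_conformalMul d
    exact ⟨h.X_mul_left, h.X_mul_right, h.C_C⟩
  · rintro mul ⟨h₁, h₂, h₃⟩
    exact IsConformalExtension.unique ⟨h₁, h₂, h₃⟩ (isConformalExtension_conformalMul d)
  · rintro mul ⟨h₁, h₂, h₃⟩
    have h : IsConformalExtension d mul := ⟨h₁, h₂, h₃⟩
    exact ⟨h.locality hnil, h.assoc hder⟩
end

section
/- There exists exactly one family of ℚ-bilinear maps ∘ₙ : A[X] × A[X] → A[X] (n ∈ ℕ) satisfying, for all p, q ∈ A[X], all a, b ∈ A and all n ∈ ℕ: (X·p) ∘ₙ q = −n·(p ∘_{n−1} q) (interpreted as 0 when n = 0); p ∘ₙ (X·q) = X·(p ∘ₙ q) + n·(p ∘_{n−1} q); and (C a) ∘ₙ (C b) = Σ_{k ≥ 0} (1/k!)·X^k·C(∂^{n+k}(a)·b) (a finite sum, since ∂ is locally nilpotent). Moreover, this family satisfies locality (for all p, q ∈ A[X] there is N with p ∘ₙ q = 0 for all n ≥ N) and conformal associativity: (p ∘ₙ q) ∘ₘ r = Σ_{s=0}^{n}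 (−1)^s (n choose s) · p ∘_{n−s} (q ∘_{m+s} r) for all p, q, r ∈ A[X] and n, m ∈ ℕ. -/
open Polynomial

namespace LocallyNilpotent

/-- Induction principle on polynomials via constants, sums and multiplication by `X`. -/
lemma polynomial_induction {R : Type*} [Semiring R] {P : R[X] → Prop} (hC : ∀ a, P (C a))
    (hadd : ∀ p q, P p → P q → P (p + q)) (hX : ∀ p, P p → P (X * p)) (p : R[X]) :
    P p := by
  induction p using Polynomial.induction_on with
  | C a => exact hC a
  | add p q hp hq => exact hadd p q hp hq
  | monomial n a h =>
    rw [pow_succ, ← mul_assoc, ← X_mul]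
    exact hX _ h

variable {A : Type*} [Ring A] [Algebra ℚ A] {d : A →ₗ[ℚ] A}

lemma iterate_eq_zero_of_le {a : A} {N k : ℕ} (h : (⇑d)^[N] a = 0) (hk : N ≤ k) :
    (⇑d)^[k] a = 0 := by
  obtain ⟨j, rfl⟩ := Nat.exists_eq_add_of_le hk
  rw [add_comm, Function.iterate_add_apply, h, iterate_map_zero]

/-- The exponential `a ↦ ∑ k, (1 / k!) • d ^ k a • X ^ k` of a locally nilpotent linear map. -/
noncomputable def exp (d : A →ₗ[ℚ] A) (hnil : ∀ a : A, ∃ N : ℕ, (⇑d)^[N] a = 0) (a : A) : A[X] :=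
  ∑ k ∈ Finset.range (hnil a).choose,
    monomial k (((1 : ℚ) / (Nat.factorial k : ℚ)) • (⇑d)^[k] a)

variable (hnil : ∀ a : A, ∃ N : ℕ, (⇑d)^[N] a = 0)

lemma coeff_exp (a : A) (k : ℕ) :
    (exp d hnil a).coeff k = ((1 : ℚ) / (Nat.factorial k : ℚ)) • (⇑d)^[k] a := by
  simp only [exp, finsetSum_coeff, coeff_monomial, Finset.sum_ite_eq', Finset.mem_range]
  split_ifs with h
  · rfl
  · rw [iterate_eq_zero_of_le (hnil a).choose_spec (not_lt.mp h), smul_zero]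

lemma exp_add (a b : A) : exp d hnil (a + b) = exp d hnil a + exp d hnil b := by
  ext k
  simp [coeff_exp, iterate_map_add, smul_add]

lemma exp_smul (c : ℚ) (a : A) : exp d hnil (c • a) = c • exp d hnil a := by
  ext k
  simp only [coeff_exp, coeff_smul, ← Module.End.pow_apply, map_smul]
  rw [smul_comm]

lemma exp_zero : exp d hnil 0 = 0 := by
  simpa using exp_smul hnil 0 0

lemma derivative_exp (a : A) : derivative (exp d hnil a) = exp d hnil (d a) := by
  ext k
  rw [coeff_derivative, coeff_exp, coeff_exp, ← Function.iterate_succ_apply]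
  have h : ((k : A) + 1) = algebraMap ℚ A (k + 1) := by simp
  rw [h, ← Algebra.commutes, ← Algebra.smul_def, smul_smul]
  congr 1
  rw [Nat.factorial_succ]
  push_cast
  field_simp

lemma exp_mul (hder : ∀ x y : A, d (x * y) = d x * y + x * d y) (a b : A) :
    exp d hnil (a * b) = exp d hnil a * exp d hnil b := by
  ext k
  induction k generalizing a b with
  | zero => simp [coeff_exp, mul_coeff_zero]
  | succ k ih =>
    have h : (derivative (exp d hnil (a * b))).coeff k =
        (derivative (exp d hnil a * exp d hnil b)).coeff k := by
      simp only [derivative_mul, derivative_exp, hder, exp_add, coeff_add, ih]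
    rw [coeff_derivative, coeff_derivative] at h
    have hk : IsUnit ((k : A) + 1) := by
      have : ((k : A) + 1) = algebraMap ℚ A (k + 1) := by simp
      rw [this]
      exact (IsUnit.mk0 _ (by positivity)).map _
    exact hk.mul_right_cancel h

lemma exp_eq_sum (a : A) {K : ℕ} (hK : (⇑d)^[K] a = 0) :
    exp d hnil a = ∑ k ∈ Finset.range K,
      ((1 : ℚ) / (Nat.factorial k : ℚ)) • (X ^ k * C ((⇑d)^[k] a)) := by
  ext j
  simp only [coeff_exp, finsetSum_coeff, coeff_smul, X_pow_mul, coeff_C_mul, coeff_X_pow,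
    mul_ite, mul_one, mul_zero, smul_ite, smul_zero, Finset.sum_ite_eq, Finset.mem_range]
  split_ifs with h
  · rfl
  · rw [iterate_eq_zero_of_le hK (not_lt.mp h), smul_zero]

/-- The conformal products on `A[X]`, generated from `p ∘₀ q = exp (p(0)) * q` by
`p ∘ₙ₊₁ q = (p ∘ₙ q)' - p' ∘ₙ q`. -/
noncomputable def conformalMul (d : A →ₗ[ℚ] A) (hnil : ∀ a : A, ∃ N : ℕ, (⇑d)^[N] a = 0) :
    ℕ → A[X] →ₗ[ℚ] A[X] →ₗ[ℚ] A[X]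
  | 0 => LinearMap.mk₂ ℚ (fun p q => exp d hnil (p.coeff 0) * q)
      (by simp [exp_add, add_mul]) (by simp [exp_smul]) (by simp [mul_add]) (by simp)
  | n + 1 => LinearMap.mk₂ ℚ
      (fun p q => derivative (conformalMul d hnil n p q) - conformalMul d hnil n (derivative p) q)
      (fun _ _ _ => by simp only [map_add, LinearMap.add_apply]; abel)
      (fun _ _ _ => by simp only [map_smul, derivative_smul, LinearMap.smul_apply, smul_sub])
      (fun _ _ _ => by simp only [map_add]; abel)
      (fun _ _ _ => by simp only [map_smul, derivative_smul, smul_sub])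

lemma conformalMul_zero_apply (p q : A[X]) :
    conformalMul d hnil 0 p q = exp d hnil (p.coeff 0) * q := by
  simp [conformalMul]

lemma conformalMul_succ_apply (n : ℕ) (p q : A[X]) :
    conformalMul d hnil (n + 1) p q =
      derivative (conformalMul d hnil n p q) - conformalMul d hnil n (derivative p) q := by
  simp [conformalMul]

lemma derivative_conformalMul (n : ℕ) (p q : A[X]) :
    derivative (conformalMul d hnil n p q) =
      conformalMul d hnil (n + 1) p q + conformalMul d hnil n (derivative p) q := by
  rw [conformalMul_succ_apply, sub_add_cancel]

lemma conformalMul_X_mul_left (p q : A[X]) (n : ℕ) :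
    conformalMul d hnil n (X * p) q = -(n : ℚ) • conformalMul d hnil (n - 1) p q := by
  induction n generalizing p with
  | zero => simp [conformalMul_zero_apply, exp_zero]
  | succ n ih =>
    rw [conformalMul_succ_apply, derivative_mul, derivative_X, one_mul, map_add,
      LinearMap.add_apply, ih, ih, derivative_smul]
    cases n with
    | zero => simp
    | succ n =>
      simp only [Nat.add_sub_cancel, derivative_conformalMul]
      push_cast
      module

lemma conformalMul_X_mul_right (p q : A[X]) (n : ℕ) :
    conformalMul d hnil n p (X * q) =
      X * conformalMul d hnil n p q + (n : ℚ) • conformalMul d hnil (n - 1) p q := by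
  induction n generalizing p with
  | zero => simp only [conformalMul_zero_apply, X_mul, mul_assoc]; simp
  | succ n ih =>
    rw [conformalMul_succ_apply, ih, ih, derivative_add, derivative_mul, derivative_X, one_mul,
      derivative_smul, derivative_conformalMul, mul_add]
    cases n with
    | zero => simp; abel
    | succ n =>
      simp only [Nat.add_sub_cancel, derivative_conformalMul]
      push_cast
      module

lemma conformalMul_C_C (a b : A) (n : ℕ) :
    conformalMul d hnil n (C a) (C b) = exp d hnil ((⇑d)^[n] a) * C b := by
  induction n with
  | zero => simp [conformalMul_zero_apply]
  | succ n ih =>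
    rw [conformalMul_succ_apply, ih, derivative_mul, derivative_C, derivative_C, map_zero,
      derivative_exp, Function.iterate_succ_apply']
    simp

lemma conformalMul_C_C_eq_sum (a b : A) (n K : ℕ) (hK : ∀ k ≥ K, (⇑d)^[k] a = 0) :
    conformalMul d hnil n (C a) (C b) = ∑ k ∈ Finset.range K,
      ((1 : ℚ) / (Nat.factorial k : ℚ)) • (X ^ k * C ((⇑d)^[n + k] a * b)) := by
  have h : (⇑d)^[K] ((⇑d)^[n] a) = 0 := by
    rw [← Function.iterate_add_apply]
    exact hK _ (Nat.le_add_right K n)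
  rw [conformalMul_C_C, exp_eq_sum hnil _ h, Finset.sum_mul]
  refine Finset.sum_congr rfl fun k _ => ?_
  rw [smul_mul_assoc, mul_assoc, ← C_mul, ← Function.iterate_add_apply, add_comm k n]

lemma conformalMul_exp_mul (hder : ∀ x y : A, d (x * y) = d x * y + x * d y)
    (a : A) (q r : A[X]) (m : ℕ) :
    conformalMul d hnil m (exp d hnil a * q) r = exp d hnil a * conformalMul d hnil m q r := by
  induction m generalizing a q with
  | zero =>
    simp [conformalMul_zero_apply, mul_coeff_zero, exp_mul hnil hder, coeff_exp, mul_assoc]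
  | succ m ih =>
    rw [conformalMul_succ_apply, ih, derivative_mul, derivative_mul, map_add, LinearMap.add_apply,
      derivative_exp, ih, ih, conformalMul_succ_apply, mul_sub]
    abel

lemma sum_neg_one_pow_mul_choose_succ {M : Type*} [AddCommGroup M] [Module ℚ M]
    (f : ℕ → ℕ → M) (n : ℕ) :
    ∑ s ∈ Finset.range (n + 2), ((-1 : ℚ) ^ s * ((n + 1).choose s : ℚ)) • f (n + 1 - s) s =
      ∑ s ∈ Finset.range (n + 1), ((-1 : ℚ) ^ s * (n.choose s : ℚ)) •
        (f (n - s + 1) s - f (n - s) (s + 1)) := by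
  have h : ∑ s ∈ Finset.range (n + 1), ((-1 : ℚ) ^ s * (n.choose s : ℚ)) • f (n - s + 1) s =
      ∑ s ∈ Finset.range (n + 2), ((-1 : ℚ) ^ s * (n.choose s : ℚ)) • f (n + 1 - s) s := by
    rw [Finset.sum_range_succ _ (n + 1), Nat.choose_succ_self]
    simp only [Nat.cast_zero, mul_zero, zero_smul, add_zero]
    refine Finset.sum_congr rfl fun s hs => ?_
    rw [Nat.sub_add_comm (Finset.mem_range_succ_iff.mp hs)]
  simp only [smul_sub, Finset.sum_sub_distrib]
  rw [h, Finset.sum_range_succ' _ (n + 1), Finset.sum_range_succ' _ (n + 1), add_sub_right_comm,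
    ← Finset.sum_sub_distrib]
  congr 1
  · refine Finset.sum_congr rfl fun s _ => ?_
    rw [Nat.choose_succ_succ, Nat.add_sub_add_right]
    push_cast
    module
  · simp

lemma conformalMul_assoc (hder : ∀ x y : A, d (x * y) = d x * y + x * d y)
    (p q r : A[X]) (n m : ℕ) :
    conformalMul d hnil m (conformalMul d hnil n p q) r =
      ∑ s ∈ Finset.range (n + 1), ((-1 : ℚ) ^ s * (n.choose s : ℚ)) •
        conformalMul d hnil (n - s) p (conformalMul d hnil (m + s) q r) := by
  induction n generalizing p m with
  | zero =>
    simp [conformalMul_zero_apply, conformalMul_exp_mul hnil hder]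
  | succ n ih =>
    have h : conformalMul d hnil m (conformalMul d hnil (n + 1) p q) r =
        derivative (conformalMul d hnil m (conformalMul d hnil n p q) r) -
          conformalMul d hnil m (conformalMul d hnil n (derivative p) q) r -
          conformalMul d hnil (m + 1) (conformalMul d hnil n p q) r := by
      rw [derivative_conformalMul hnil m, derivative_conformalMul hnil n, map_add,
        LinearMap.add_apply]
      abel
    rw [h, ih, ih, ih, derivative_sum, ← Finset.sum_sub_distrib, ← Finset.sum_sub_distrib,
      sum_neg_one_pow_mul_choose_succ
        (fun i s => conformalMul d hnil i p (conformalMul d hnil (m + s) q r))]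
    refine Finset.sum_congr rfl fun s _ => ?_
    rw [derivative_smul, derivative_conformalMul, add_right_comm m 1 s, ← add_assoc m s 1]
    module

lemma conformalMul_locality (p q : A[X]) :
    ∃ N : ℕ, ∀ n ≥ N, conformalMul d hnil n p q = 0 := by
  induction p using polynomial_induction with
  | hC a =>
    induction q using polynomial_induction with
    | hC b =>
      obtain ⟨N, hN⟩ := hnil a
      refine ⟨N, fun n hn => ?_⟩
      rw [conformalMul_C_C, iterate_eq_zero_of_le hN hn, exp_zero, zero_mul]
    | hadd p q hp hq =>
      obtain ⟨M, hM⟩ := hp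
      obtain ⟨N, hN⟩ := hq
      refine ⟨max M N, fun n hn => ?_⟩
      rw [map_add, hM n (le_of_max_le_left hn), hN n (le_of_max_le_right hn), add_zero]
    | hX q hq =>
      obtain ⟨N, hN⟩ := hq
      refine ⟨N + 1, fun n hn => ?_⟩
      rw [conformalMul_X_mul_right, hN n (by omega), hN (n - 1) (by omega)]
      simp
  | hadd p p' hp hp' =>
    obtain ⟨M, hM⟩ := hp
    obtain ⟨N, hN⟩ := hp'
    refine ⟨max M N, fun n hn => ?_⟩
    rw [map_add, LinearMap.add_apply, hM n (le_of_max_le_left hn), hN n (le_of_max_le_right hn),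
      add_zero]
  | hX p hp =>
    obtain ⟨N, hN⟩ := hp
    refine ⟨N + 1, fun n hn => ?_⟩
    rw [conformalMul_X_mul_left, hN (n - 1) (by omega), smul_zero]

lemma eq_of_sesquilinear_of_eq_on_C {mul mul' : ℕ → A[X] →ₗ[ℚ] A[X] →ₗ[ℚ] A[X]}
    (hl : ∀ (p q : A[X]) (n : ℕ), mul n (X * p) q = -(n : ℚ) • mul (n - 1) p q)
    (hr : ∀ (p q : A[X]) (n : ℕ), mul n p (X * q) = X * mul n p q + (n : ℚ) • mul (n - 1) p q)
    (hl' : ∀ (p q : A[X]) (n : ℕ), mul' n (X * p) q = -(n : ℚ) • mul' (n - 1) p q)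
    (hr' : ∀ (p q : A[X]) (n : ℕ),
      mul' n p (X * q) = X * mul' n p q + (n : ℚ) • mul' (n - 1) p q)
    (hC : ∀ (a b : A) (n : ℕ), mul n (C a) (C b) = mul' n (C a) (C b)) : mul = mul' := by
  suffices h : ∀ (p q : A[X]) (n : ℕ), mul n p q = mul' n p q from
    funext fun n => LinearMap.ext₂ fun p q => h p q n
  intro p q
  induction p using polynomial_induction with
  | hC a =>
    induction q using polynomial_induction with
    | hC b => exact hC a b
    | hadd p q hp hq => intro n; rw [map_add, map_add, hp, hq]
    | hX q hq => intro n; rw [hr, hr', hq, hq]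
  | hadd p p' hp hp' =>
    intro n
    rw [map_add, map_add, LinearMap.add_apply, LinearMap.add_apply, hp, hp']
  | hX p hp => intro n; rw [hl, hl', hp]

end LocallyNilpotent

theorem unique_conformal_products_shifted
    (A : Type*) [Ring A] [Algebra ℚ A]
    (d : A →ₗ[ℚ] A)
    (hder : ∀ x y : A, d (x * y) = d x * y + x * d y)
    (hnil : ∀ a : A, ∃ N : ℕ, (⇑d)^[N] a = 0) :
    (∃! mul : ℕ → A[X] →ₗ[ℚ] A[X] →ₗ[ℚ] A[X],
      (∀ (p q : A[X]) (n : ℕ), mul n (X * p) q = -(n : ℚ) • mul (n - 1) p q) ∧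
      (∀ (p q : A[X]) (n : ℕ),
        mul n p (X * q) = X * mul n p q + (n : ℚ) • mul (n - 1) p q) ∧
      (∀ (a b : A) (n : ℕ), ∀ K : ℕ, (∀ k ≥ K, (⇑d)^[k] a = 0) →
        mul n (C a) (C b) =
          ∑ k ∈ Finset.range K,
            ((1 : ℚ) / (Nat.factorial k : ℚ)) • (X ^ k * C ((⇑d)^[n + k] a * b)))) ∧
    (∀ mul : ℕ → A[X] →ₗ[ℚ] A[X] →ₗ[ℚ] A[X],
      ((∀ (p q : A[X]) (n : ℕ), mul n (X * p) q = -(n : ℚ) • mul (n - 1) p q) ∧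
       (∀ (p q : A[X]) (n : ℕ),
         mul n p (X * q) = X * mul n p q + (n : ℚ) • mul (n - 1) p q) ∧
       (∀ (a b : A) (n : ℕ), ∀ K : ℕ, (∀ k ≥ K, (⇑d)^[k] a = 0) →
         mul n (C a) (C b) =
           ∑ k ∈ Finset.range K,
             ((1 : ℚ) / (Nat.factorial k : ℚ)) • (X ^ k * C ((⇑d)^[n + k] a * b)))) →
      -- locality
      (∀ p q : A[X], ∃ N : ℕ, ∀ n ≥ N, mul n p q = 0) ∧
      -- conformal associativity
      (∀ (p q r : A[X]) (n m : ℕ),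
        mul m (mul n p q) r =
          ∑ s ∈ Finset.range (n + 1),
            ((-1 : ℚ) ^ s * (n.choose s : ℚ)) • mul (n - s) p (mul (m + s) q r))) := by
  have huniq : ∀ mul : ℕ → A[X] →ₗ[ℚ] A[X] →ₗ[ℚ] A[X],
      ((∀ (p q : A[X]) (n : ℕ), mul n (X * p) q = -(n : ℚ) • mul (n - 1) p q) ∧
       (∀ (p q : A[X]) (n : ℕ),
         mul n p (X * q) = X * mul n p q + (n : ℚ) • mul (n - 1) p q) ∧
       (∀ (a b : A) (n : ℕ), ∀ K : ℕ, (∀ k ≥ K, (⇑d)^[k] a = 0) →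
         mul n (C a) (C b) =
           ∑ k ∈ Finset.range K,
             ((1 : ℚ) / (Nat.factorial k : ℚ)) • (X ^ k * C ((⇑d)^[n + k] a * b)))) →
      mul = LocallyNilpotent.conformalMul d hnil := by
    rintro mul ⟨hl, hr, hC⟩
    refine LocallyNilpotent.eq_of_sesquilinear_of_eq_on_C hl hr
      (LocallyNilpotent.conformalMul_X_mul_left hnil)
      (LocallyNilpotent.conformalMul_X_mul_right hnil) fun a b n => ?_
    obtain ⟨N, hN⟩ := hnil a
    have hK : ∀ k ≥ N, (⇑d)^[k] a = 0 := fun k hk =>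
      LocallyNilpotent.iterate_eq_zero_of_le hN hk
    rw [hC a b n N hK, LocallyNilpotent.conformalMul_C_C_eq_sum hnil a b n N hK]
  refine ⟨⟨LocallyNilpotent.conformalMul d hnil,
    ⟨LocallyNilpotent.conformalMul_X_mul_left hnil, LocallyNilpotent.conformalMul_X_mul_right hnil,
      LocallyNilpotent.conformalMul_C_C_eq_sum hnil⟩, huniq⟩, fun mul hmul => ?_⟩
  rw [huniq mul hmul]
  exact ⟨LocallyNilpotent.conformalMul_locality hnil,
    LocallyNilpotent.conformalMul_assoc hnil hder⟩
end

section
/- The family of elements G(a₁, …, a_{k+1}; n₁, …, n_k) ∈ F, indexed by all normal tuples (over all k ≥ 0, all aᵢ ∈ B and all 0 ≤ nᵢ < n(a_{i+1})), is linearly independent over ℚ. -/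
/-- The word consisting of the single letter `v`. -/
def vWord (B : Type*) : FreeMonoid (B ⊕ Unit) := FreeMonoid.of (Sum.inr ())

/-- The word consisting of the single letter `a ∈ B`. -/
def aWord {B : Type*} (a : B) : FreeMonoid (B ⊕ Unit) := FreeMonoid.of (Sum.inl a)

/-- The first generator of the tuple encoded by `(l, last)` after a virtual head:
the first component of the head of `l`, or `last` if `l` is empty. -/
def nextHead {B : Type*} : List (B × ℕ) → B → B
  | [], a => a
  | (b, _) :: _, _ => b

/-- The tuple `(a₁, …, a_{k+1}; n₁, …, n_k)`, encoded as the list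
`[(a₁,n₁),…,(a_k,n_k)]` together with `a_{k+1}`, is normal if `nᵢ < n(a_{i+1})`
for all `i`. -/
inductive IsNormalTuple {B : Type*} (n : B → ℕ) : List (B × ℕ) → B → Prop
  | nil (a : B) : IsNormalTuple n [] a
  | cons (a : B) (m : ℕ) (rest : List (B × ℕ)) (last : B)
      (hm : m < n (nextHead rest last)) (hrest : IsNormalTuple n rest last) :
      IsNormalTuple n ((a, m) :: rest) last

/-- The element `G(a₁, …, a_{k+1}; n₁, …, n_k)` of the monoid algebra,
defined recursively by `G(a) = v^{n(a)−1}·a` and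
`G(a₁, …, a_{k+1}; n₁, …, n_k) = v^{n(a₁)−1}·a₁·∂^{n₁}(G(a₂, …, a_{k+1}; n₂, …, n_k))`. -/
noncomputable def Gelem {B : Type*} (n : B → ℕ)
    (d : MonoidAlgebra ℚ (FreeMonoid (B ⊕ Unit)) →ₗ[ℚ] MonoidAlgebra ℚ (FreeMonoid (B ⊕ Unit))) :
    List (B × ℕ) → B → MonoidAlgebra ℚ (FreeMonoid (B ⊕ Unit))
  | [], a => MonoidAlgebra.of ℚ (FreeMonoid (B ⊕ Unit)) ((vWord B) ^ (n a - 1) * aWord a)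
  | (a, m) :: rest, last =>
      MonoidAlgebra.of ℚ (FreeMonoid (B ⊕ Unit)) ((vWord B) ^ (n a - 1) * aWord a) *
        (⇑d)^[m] (Gelem n d rest last)

/-- The shape of a word: `true` for each letter `v` and `false` for each letter of `B`.
Shapes are compared lexicographically. -/
def wordShape {B : Type*} (w : FreeMonoid (B ⊕ Unit)) : List Bool :=
  w.toList.map Sum.isRight

theorem wordShape_mul {B : Type*} (u w : FreeMonoid (B ⊕ Unit)) :
    wordShape (u * w) = wordShape u ++ wordShape w := by
  simp [wordShape]

theorem wordShape_mul_lt {B : Type*} (u : FreeMonoid (B ⊕ Unit)) {w w' : FreeMonoid (B ⊕ Unit)}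
    (h : wordShape w < wordShape w') : wordShape (u * w) < wordShape (u * w') := by
  rw [wordShape_mul, wordShape_mul]
  exact List.append_left_lt h

theorem wordShape_aWord_mul_lt {B : Type*} (a : B) (w u : FreeMonoid (B ⊕ Unit)) :
    wordShape (aWord a * w) < wordShape (vWord B * u) := by
  simp [wordShape, aWord, vWord, List.cons_lt_cons_iff]

/-- The word `w` occurs in `x`, and all other words occurring in `x` have larger shape. -/
def IsLeastWord {B : Type*} (x : MonoidAlgebra ℚ (FreeMonoid (B ⊕ Unit)))
    (w : FreeMonoid (B ⊕ Unit)) : Prop :=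
  x.coeff w ≠ 0 ∧ ∀ u, x.coeff u ≠ 0 → u = w ∨ wordShape w < wordShape u

theorem isLeastWord_one {B : Type*} :
    IsLeastWord (1 : MonoidAlgebra ℚ (FreeMonoid (B ⊕ Unit))) 1 := by
  refine ⟨by simp, fun u hu => Or.inl ?_⟩
  by_contra h
  exact hu (by simp [MonoidAlgebra.one_def, Ne.symm h])

theorem exists_eq_mul_of_coeff_of_mul_ne_zero {R M : Type*} [Semiring R] [Monoid M]
    {m u : M} {x : MonoidAlgebra R M}
    (h : (MonoidAlgebra.of R M m * x).coeff u ≠ 0) : ∃ t, u = m * t := by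
  by_contra! hne
  exact h (by
    rw [MonoidAlgebra.of_apply]
    exact MonoidAlgebra.coeff_single_mul_of_forall_mul_ne _ _ fun t => (hne t).symm)

theorem coeff_of_mul_mul {R M : Type*} [Semiring R] [Monoid M] [IsLeftCancelMul M]
    (m t : M) (x : MonoidAlgebra R M) :
    (MonoidAlgebra.of R M m * x).coeff (m * t) = x.coeff t := by
  rw [MonoidAlgebra.of_apply, MonoidAlgebra.coeff_single_mul_eq_mul_coeff t (by simp), one_mul]

theorem IsLeastWord.of_mul {B : Type*} {x : MonoidAlgebra ℚ (FreeMonoid (B ⊕ Unit))}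
    {w : FreeMonoid (B ⊕ Unit)} (h : IsLeastWord x w) (u : FreeMonoid (B ⊕ Unit)) :
    IsLeastWord (MonoidAlgebra.of ℚ _ u * x) (u * w) := by
  refine ⟨by rw [coeff_of_mul_mul]; exact h.1, fun s hs => ?_⟩
  obtain ⟨t, rfl⟩ := exists_eq_mul_of_coeff_of_mul_ne_zero hs
  rw [coeff_of_mul_mul] at hs
  exact (h.2 t hs).imp (congrArg _) (wordShape_mul_lt u)

theorem IsLeastWord.smul_add {B : Type*} {x y : MonoidAlgebra ℚ (FreeMonoid (B ⊕ Unit))}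
    {w : FreeMonoid (B ⊕ Unit)} (h : IsLeastWord x w) {c : ℚ} (hc : c ≠ 0)
    (hy : ∀ u, y.coeff u ≠ 0 → wordShape w < wordShape u) : IsLeastWord (c • x + y) w := by
  have hyw : y.coeff w = 0 := by
    by_contra hne
    exact lt_irrefl _ (hy w hne)
  refine ⟨by simp [hyw, hc, h.1], fun u hu => ?_⟩
  by_cases hyu : y.coeff u = 0
  · refine h.2 u fun hxu => hu (by simp [hyu, hxu])
  · exact Or.inr (hy u hyu)

theorem linearIndependent_of_isLeastWord {ι B : Type*}
    (x : ι → MonoidAlgebra ℚ (FreeMonoid (B ⊕ Unit))) (w : ι → FreeMonoid (B ⊕ Unit))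
    (hw : Function.Injective w) (h : ∀ i, IsLeastWord (x i) (w i)) :
    LinearIndependent ℚ x := by
  rw [linearIndependent_iff]
  intro l hl
  by_contra hne
  obtain ⟨i, hi, hmin⟩ := l.support.exists_min_image (fun i => wordShape (w i))
    (Finsupp.support_nonempty_iff.mpr hne)
  have hcoeff := congrArg (fun y => MonoidAlgebra.coeff y (w i)) hl
  simp only [Finsupp.linearCombination_apply, Finsupp.sum, MonoidAlgebra.coeff_sum,
    Finsupp.finsetSum_apply, MonoidAlgebra.coeff_smul_apply, MonoidAlgebra.coeff_zero,
    Finsupp.zero_apply] at hcoeff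
  rw [Finset.sum_eq_single_of_mem i hi] at hcoeff
  · exact mul_ne_zero (Finsupp.mem_support_iff.mp hi) (h i).1 hcoeff
  · intro j hj hji
    by_contra hxj
    rcases (h j).2 (w i) fun h0 => hxj (by simp [h0]) with heq | hlt
    · exact hji (hw heq).symm
    · exact absurd hlt (hmin j hj).not_gt

theorem derivation_pow_succ {A : Type*} [Ring A] [Algebra ℚ A] (d : A →ₗ[ℚ] A)
    (hder : ∀ x y, d (x * y) = d x * y + x * d y) {v : A} (hv : d v = 1) (j : ℕ) :
    d (v ^ (j + 1)) = ((j : ℚ) + 1) • v ^ j := by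
  induction j with
  | zero => simp [hv]
  | succ j ih =>
    rw [pow_succ, hder, ih, hv, smul_mul_assoc, ← pow_succ, mul_one]
    push_cast
    module

/-- Differentiating `v ^ M * a * y` at most `M` times lowers the leading power of `v`,
up to terms divisible on the left by a higher power of `v`. -/
theorem exists_iterate_derivation_eq {A : Type*} [Ring A] [Algebra ℚ A] (d : A →ₗ[ℚ] A)
    (hder : ∀ x y, d (x * y) = d x * y + x * d y) {v a : A} (hv : d v = 1) (ha : d a = 0)
    (y : A) (m k : ℕ) :
    ∃ c : ℚ, c ≠ 0 ∧ ∃ z, d^[m] (v ^ (k + m) * (a * y)) =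
      c • (v ^ k * (a * y)) + v ^ (k + 1) * z := by
  induction m generalizing k with
  | zero => exact ⟨1, one_ne_zero, 0, by simp⟩
  | succ m ih =>
    obtain ⟨c, hc, z, hz⟩ := ih (k + 1)
    refine ⟨c * (k + 1), mul_ne_zero hc (by positivity),
      c • (a * d y) + ((k : ℚ) + 2) • z + v * d z, ?_⟩
    rw [Function.iterate_succ_apply', show k + (m + 1) = k + 1 + m by omega, hz, map_add,
      map_smul, hder, hder _ z, hder a, ha, derivation_pow_succ d hder hv,
      derivation_pow_succ d hder hv, zero_mul, zero_add, pow_succ _ (k + 1)]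
    simp only [smul_mul_assoc, mul_add, mul_smul_comm, mul_assoc]
    push_cast
    module

/-- The least word of `∂^m (G(a₁, …, a_{k+1}; n₁, …, n_k))`. -/
def leastWord {B : Type*} (n : B → ℕ) : ℕ → List (B × ℕ) → B → FreeMonoid (B ⊕ Unit)
  | m, [], a => vWord B ^ (n a - 1 - m) * (aWord a * 1)
  | m, (a, m') :: rest, last =>
      vWord B ^ (n a - 1 - m) * (aWord a * leastWord n m' rest last)

theorem isLeastWord_iterate_derivation {B : Type*}
    (d : MonoidAlgebra ℚ (FreeMonoid (B ⊕ Unit)) →ₗ[ℚ] MonoidAlgebra ℚ (FreeMonoid (B ⊕ Unit)))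
    (hder : ∀ x y, d (x * y) = d x * y + x * d y)
    (hv : d (MonoidAlgebra.of ℚ (FreeMonoid (B ⊕ Unit)) (vWord B)) = 1)
    (ha : ∀ a : B, d (MonoidAlgebra.of ℚ (FreeMonoid (B ⊕ Unit)) (aWord a)) = 0)
    {y : MonoidAlgebra ℚ (FreeMonoid (B ⊕ Unit))} {w : FreeMonoid (B ⊕ Unit)}
    (hy : IsLeastWord y w) (a : B) {m M : ℕ} (hm : m ≤ M) :
    IsLeastWord (d^[m] (MonoidAlgebra.of ℚ _ (vWord B ^ M * aWord a) * y))
      (vWord B ^ (M - m) * (aWord a * w)) := by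
  obtain ⟨k, rfl⟩ := Nat.exists_eq_add_of_le' hm
  obtain ⟨c, hc, z, hz⟩ := exists_iterate_derivation_eq d hder hv (ha a) y m k
  rw [map_mul, map_pow, mul_assoc, hz, Nat.add_sub_cancel, ← map_pow, ← map_pow]
  refine ((hy.of_mul _).of_mul _).smul_add hc fun u hu => ?_
  obtain ⟨t, rfl⟩ := exists_eq_mul_of_coeff_of_mul_ne_zero hu
  rw [pow_succ, mul_assoc]
  exact wordShape_mul_lt _ (wordShape_aWord_mul_lt _ _ _)

theorem isLeastWord_iterate_Gelem {B : Type*}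
    (d : MonoidAlgebra ℚ (FreeMonoid (B ⊕ Unit)) →ₗ[ℚ] MonoidAlgebra ℚ (FreeMonoid (B ⊕ Unit)))
    (hder : ∀ x y, d (x * y) = d x * y + x * d y)
    (hv : d (MonoidAlgebra.of ℚ (FreeMonoid (B ⊕ Unit)) (vWord B)) = 1)
    (ha : ∀ a : B, d (MonoidAlgebra.of ℚ (FreeMonoid (B ⊕ Unit)) (aWord a)) = 0)
    (n : B → ℕ) {l : List (B × ℕ)} {last : B} (hl : IsNormalTuple n l last) {m : ℕ}
    (hm : m < n (nextHead l last)) :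
    IsLeastWord (d^[m] (Gelem n d l last)) (leastWord n m l last) := by
  induction hl generalizing m with
  | nil a =>
    have h := isLeastWord_iterate_derivation d hder hv ha isLeastWord_one a (Nat.le_sub_one_of_lt hm)
    rwa [mul_one] at h
  | cons a m' rest last hm' _ ih =>
    exact isLeastWord_iterate_derivation d hder hv ha (ih hm') a (Nat.le_sub_one_of_lt hm)

theorem vWord_pow_mul_aWord_mul_inj {B : Type*} {j j' : ℕ} {a a' : B}
    {w w' : FreeMonoid (B ⊕ Unit)}
    (h : vWord B ^ j * (aWord a * w) = vWord B ^ j' * (aWord a' * w')) :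
    j = j' ∧ a = a' ∧ w = w' := by
  induction j generalizing j' with
  | zero =>
    cases j' with
    | zero =>
      have := congrArg FreeMonoid.toList h
      simpa [aWord] using this
    | succ j' =>
      have := congrArg FreeMonoid.toList h
      simp [aWord, vWord, pow_succ', mul_assoc] at this
  | succ j ih =>
    cases j' with
    | zero =>
      have := congrArg FreeMonoid.toList h
      simp [aWord, vWord, pow_succ', mul_assoc] at this
    | succ j' =>
      rw [pow_succ', pow_succ', mul_assoc, mul_assoc] at h
      obtain ⟨rfl, h'⟩ := ih (mul_left_cancel h)
      exact ⟨rfl, h'⟩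

theorem leastWord_ne_one {B : Type*} (n : B → ℕ) (m : ℕ) (l : List (B × ℕ)) (last : B) :
    leastWord n m l last ≠ 1 := by
  intro h
  have := congrArg FreeMonoid.toList h
  cases l <;> simp [leastWord, aWord] at this

theorem leastWord_inj {B : Type*} (n : B → ℕ) {l l' : List (B × ℕ)} {last last' : B} {m m' : ℕ}
    (hl : IsNormalTuple n l last) (hl' : IsNormalTuple n l' last')
    (hm : m < n (nextHead l last)) (hm' : m' < n (nextHead l' last'))
    (h : leastWord n m l last = leastWord n m' l' last') :
    m = m' ∧ l = l' ∧ last = last' := by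
  induction hl generalizing m m' l' with
  | nil a =>
    cases hl' with
    | nil a' =>
      obtain ⟨hj, rfl, -⟩ := vWord_pow_mul_aWord_mul_inj h
      simp only [nextHead] at hm hm'
      exact ⟨by omega, rfl, rfl⟩
    | cons b k rest last' _ _ =>
      exact absurd (vWord_pow_mul_aWord_mul_inj h).2.2.symm (leastWord_ne_one _ _ _ _)
  | cons a k rest last hk _ ih =>
    cases hl' with
    | nil a' => exact absurd (vWord_pow_mul_aWord_mul_inj h).2.2 (leastWord_ne_one _ _ _ _)
    | cons b k' rest' last' hk' hrest' =>
      obtain ⟨hj, rfl, hrest⟩ := vWord_pow_mul_aWord_mul_inj h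
      obtain ⟨rfl, rfl, rfl⟩ := ih hrest' hk hk' hrest
      simp only [nextHead] at hm hm'
      exact ⟨by omega, rfl, rfl⟩

theorem normal_words_linearIndependent
    (B : Type*) [LinearOrder B]
    (d : MonoidAlgebra ℚ (FreeMonoid (B ⊕ Unit)) →ₗ[ℚ] MonoidAlgebra ℚ (FreeMonoid (B ⊕ Unit)))
    (hder : ∀ x y, d (x * y) = d x * y + x * d y)
    (hv : d (MonoidAlgebra.of ℚ (FreeMonoid (B ⊕ Unit)) (vWord B)) = 1)
    (ha : ∀ a : B, d (MonoidAlgebra.of ℚ (FreeMonoid (B ⊕ Unit)) (aWord a)) = 0)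
    (n : B → ℕ) (hn : ∀ a, 1 ≤ n a) :
    LinearIndependent ℚ
      (fun p : {p : List (B × ℕ) × B // IsNormalTuple n p.1 p.2} =>
        Gelem n d p.val.1 p.val.2) := by
  refine linearIndependent_of_isLeastWord _ (fun p => leastWord n 0 p.val.1 p.val.2) ?_
    fun p => isLeastWord_iterate_Gelem d hder hv ha n p.property (hn _)
  intro p q h
  obtain ⟨-, h₁, h₂⟩ := leastWord_inj n p.property q.property (hn _) (hn _) h
  exact Subtype.ext (Prod.ext h₁ h₂)
end

section
/- Fix n : B → ℕ with n(a) ≥ 1 for all a ∈ B. Suppose ∘ₙ (n ∈ ℕ) is a family of ℚ-bilinear products on F[X] = Polynomial F satisfying, for all p, q ∈ F[X], all x, y ∈ F and all n ∈ ℕ: (X·p) ∘ₙ q = −n·(p ∘_{n−1} q) (interpreted as 0 when n = 0); p ∘ₙ (X·q) = X·(p ∘ₙ q) + n·(p ∘_{n−1} q); and (C x) ∘ₙ (C y) = (−1)ⁿ·C(x·∂ⁿ(y)). Put g(a) = C(v^{n(a)−1}·a) ∈ F[X] for a ∈ B, and let G be the smallest ℚ-subspace of F[X] containing all g(a), closed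 under multiplication by X and closed under all products ∘ₙ. Let C′ be an associative conformal algebra over ℚ with derivation D′ and products ∘′ₙ, and let φ₀ : B → C′ be a map such that φ₀(a) ∘′ₘ φ₀(b) = 0 whenever m ≥ n(b), and such that C′ is generated by φ₀(B) (the only ℚ-subspace of C′ containing φ₀(B) and closed under D′ and all ∘′ₙ is C′ itself). Then there exists a surjective ℚ-linear map Φ : G → C′ with Φ(g(a)) = φ₀(a) for all a ∈ B, Φ(X·x) = D′(Φ(x)) for all x ∈ G, and Φ(x ∘ₙ y) = Φ(x) ∘′ₙ Φ(y) for all x, y ∈ G and n ∈ ℕ. -/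
open Polynomial

/-- The extra generator `v` of the free algebra `F = FreeAlgebra ℚ (B ⊕ Unit)`. -/
noncomputable def vGen (B : Type*) : FreeAlgebra ℚ (B ⊕ Unit) :=
  FreeAlgebra.ι ℚ (Sum.inr () : B ⊕ Unit)

/-- The generator `a ∈ B` of the free algebra `F = FreeAlgebra ℚ (B ⊕ Unit)`. -/
noncomputable def aGen {B : Type*} (a : B) : FreeAlgebra ℚ (B ⊕ Unit) :=
  FreeAlgebra.ι ℚ (Sum.inl a : B ⊕ Unit)

section OperatorIdentities

/-- Binomial inversion for a doubly indexed family. -/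
theorem binomial_inversion {V : Type*} [AddCommGroup V] [Module ℚ V] (P Q : ℕ → ℕ → V)
    (h : ∀ k m, Q k m = ∑ s ∈ Finset.range (k + 1),
      ((-1 : ℚ) ^ s * (k.choose s : ℚ)) • P (k - s) (m + s)) (k m : ℕ) :
    P k m = ∑ s ∈ Finset.range (k + 1), (k.choose s : ℚ) • Q (k - s) (m + s) := by
  let S₁ : Module.End ℚ (ℕ → ℕ → V) :=
    { toFun := fun f i j => f (i + 1) j
      map_add' := fun _ _ => rfl
      map_smul' := fun _ _ => rfl }
  let S₂ : Module.End ℚ (ℕ → ℕ → V) :=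
    { toFun := fun f i j => f i (j + 1)
      map_add' := fun _ _ => rfl
      map_smul' := fun _ _ => rfl }
  have hS₁ : ∀ (r : ℕ) (f : ℕ → ℕ → V) (i j : ℕ), (S₁ ^ r) f i j = f (i + r) j := by
    intro r
    induction r with
    | zero => intros; rfl
    | succ r ih =>
      intro f i j
      rw [pow_succ, Module.End.mul_apply, ih]
      rfl
  have hS₂ : ∀ (r : ℕ) (f : ℕ → ℕ → V) (i j : ℕ), (S₂ ^ r) f i j = f i (j + r) := by
    intro r
    induction r with
    | zero => intros; rfl
    | succ r ih =>
      intro f i j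
      rw [pow_succ, Module.End.mul_apply, ih]
      rfl
  have hcomm : Commute S₂ S₁ := rfl
  have hQ : ∀ k m, ((S₁ - S₂) ^ k) P 0 m = Q k m := by
    intro k m
    have hneg : Commute (-S₂) S₁ := hcomm.neg_left
    rw [sub_eq_neg_add, hneg.add_pow, h, LinearMap.sum_apply, Finset.sum_apply, Finset.sum_apply]
    refine Finset.sum_congr rfl fun s _ => ?_
    rw [← nsmul_eq_mul', ← Nat.cast_smul_eq_nsmul ℚ, ← neg_one_smul ℚ S₂, _root_.smul_pow]
    simp only [smul_mul_assoc, smul_smul, LinearMap.smul_apply, Pi.smul_apply,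
      Module.End.mul_apply, hS₂, hS₁, zero_add]
    rw [mul_comm]
  have hsub : Commute S₂ (S₁ - S₂) := hcomm.sub_right (Commute.refl S₂)
  calc P k m = (S₁ ^ k) P 0 m := by rw [hS₁, zero_add]
    _ = ((S₂ + (S₁ - S₂)) ^ k) P 0 m := by rw [add_sub_cancel]
    _ = _ := by
      rw [hsub.add_pow, LinearMap.sum_apply, Finset.sum_apply, Finset.sum_apply]
      refine Finset.sum_congr rfl fun s _ => ?_
      rw [← nsmul_eq_mul', ← Nat.cast_smul_eq_nsmul ℚ, LinearMap.smul_apply, Pi.smul_apply,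
        Pi.smul_apply, Module.End.mul_apply, hS₂, hQ]

/-- Leibniz rule for the iterates of a derivation of a not necessarily commutative algebra. -/
theorem iterate_leibniz {A : Type*} [Ring A] [Algebra ℚ A] (d : A →ₗ[ℚ] A)
    (hd : ∀ x y, d (x * y) = d x * y + x * d y) (k : ℕ) (x y : A) :
    d^[k] (x * y) = ∑ s ∈ Finset.range (k + 1),
      (k.choose s : ℚ) • (d^[k - s] x * d^[s] y) := by
  let L : Module.End ℚ (TensorProduct ℚ A A) := TensorProduct.map d LinearMap.id
  let R : Module.End ℚ (TensorProduct ℚ A A) := TensorProduct.map LinearMap.id d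
  have hcomm : Commute R L := by
    change R ∘ₗ L = L ∘ₗ R
    simp only [L, R, ← TensorProduct.map_comp, LinearMap.id_comp, LinearMap.comp_id]
  have hmul : ∀ t, d (LinearMap.mul' ℚ A t) = LinearMap.mul' ℚ A ((R + L) t) := by
    intro t
    induction t with
    | zero => simp
    | tmul a b => simp [L, R, hd, add_comm]
    | add a b ha hb => simp only [map_add, ha, hb]
  have hiter : ∀ k t, d^[k] (LinearMap.mul' ℚ A t) = LinearMap.mul' ℚ A (((R + L) ^ k) t) := by
    intro k
    induction k with
    | zero => intro t; rfl
    | succ k ih =>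
      intro t
      rw [Function.iterate_succ_apply, hmul, ih, pow_succ, Module.End.mul_apply]
  have hL : ∀ r a b, (L ^ r) (a ⊗ₜ[ℚ] b) = (d^[r] a) ⊗ₜ[ℚ] b := by
    intro r
    induction r with
    | zero => intros; rfl
    | succ r ih =>
      intro a b
      rw [pow_succ, Module.End.mul_apply, Function.iterate_succ_apply, ← ih]
      rfl
  have hR : ∀ r a b, (R ^ r) (a ⊗ₜ[ℚ] b) = a ⊗ₜ[ℚ] (d^[r] b) := by
    intro r
    induction r with
    | zero => intros; rfl
    | succ r ih =>
      intro a b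
      rw [pow_succ, Module.End.mul_apply, Function.iterate_succ_apply, ← ih]
      rfl
  rw [← LinearMap.mul'_apply (R := ℚ), hiter, hcomm.add_pow, LinearMap.sum_apply, map_sum]
  refine Finset.sum_congr rfl fun s _ => ?_
  rw [← nsmul_eq_mul', ← Nat.cast_smul_eq_nsmul ℚ, LinearMap.smul_apply, map_smul,
    Module.End.mul_apply, hL, hR, LinearMap.mul'_apply]

end OperatorIdentities

section Words

variable {B : Type*}

/-- Words `v^{n(a₁)-1} a₁ v^{j₂} a₂ ⋯ v^{jᵣ} aᵣ` with `jᵢ < n(aᵢ)`. -/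
inductive IsConformalWord (n : B → ℕ) : FreeAlgebra ℚ (B ⊕ Unit) → Prop
  | gen (a : B) : IsConformalWord n (vGen B ^ (n a - 1) * aGen a)
  | snoc {x : FreeAlgebra ℚ (B ⊕ Unit)} (hx : IsConformalWord n x) {j : ℕ} {b : B}
      (hj : j < n b) : IsConformalWord n (x * (vGen B ^ j * aGen b))

/-- The subalgebra generated by the `v^j b` with `j < n(b)`. -/
def atomAlgebra (n : B → ℕ) : Subalgebra ℚ (FreeAlgebra ℚ (B ⊕ Unit)) :=
  Algebra.adjoin ℚ {x | ∃ (b : B) (j : ℕ), j < n b ∧ x = vGen B ^ j * aGen b}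

theorem atom_mem_atomAlgebra {n : B → ℕ} {b : B} {j : ℕ} (hj : j < n b) :
    vGen B ^ j * aGen b ∈ atomAlgebra n :=
  Algebra.subset_adjoin ⟨b, j, hj, rfl⟩

theorem IsConformalWord.mem_atomAlgebra {n : B → ℕ} (hn : ∀ a, 1 ≤ n a)
    {x : FreeAlgebra ℚ (B ⊕ Unit)} (hx : IsConformalWord n x) : x ∈ atomAlgebra n := by
  induction hx with
  | gen a => exact atom_mem_atomAlgebra (Nat.sub_lt (hn a) one_pos)
  | snoc _ hj ih => exact mul_mem ih (atom_mem_atomAlgebra hj)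

/-- The span of the conformal words. -/
def wordSpan (n : B → ℕ) : Submodule ℚ (FreeAlgebra ℚ (B ⊕ Unit)) :=
  Submodule.span ℚ {x | IsConformalWord n x}

theorem mul_mem_wordSpan {n : B → ℕ} {x w : FreeAlgebra ℚ (B ⊕ Unit)}
    (hx : x ∈ wordSpan n) (hw : w ∈ atomAlgebra n) : x * w ∈ wordSpan n := by
  induction hw using Algebra.adjoin_induction generalizing x with
  | mem w hw =>
    obtain ⟨b, j, hj, rfl⟩ := hw
    induction hx using Submodule.span_induction with
    | mem x hx => exact Submodule.subset_span (hx.snoc hj)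
    | zero => simp
    | add x y _ _ hx hy => rw [add_mul]; exact add_mem hx hy
    | smul r x _ hx => rw [smul_mul_assoc]; exact Submodule.smul_mem _ _ hx
  | algebraMap r =>
    rw [← Algebra.commutes, ← Algebra.smul_def]
    exact Submodule.smul_mem _ _ hx
  | add w w' _ _ h h' => rw [mul_add]; exact add_mem (h hx) (h' hx)
  | mul w w' _ _ h h' => rw [← mul_assoc]; exact h' (h hx)

variable {d : FreeAlgebra ℚ (B ⊕ Unit) →ₗ[ℚ] FreeAlgebra ℚ (B ⊕ Unit)}
  (hder : ∀ x y, d (x * y) = d x * y + x * d y)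
  (hdv : d (vGen B) = 1) (hda : ∀ a : B, d (aGen a) = 0)

include hder in
theorem leibniz_map_one : d 1 = 0 := by
  simpa using hder 1 1

include hder hdv in
theorem deriv_vGen_pow (j : ℕ) : d (vGen B ^ j) = (j : ℚ) • vGen B ^ (j - 1) := by
  induction j with
  | zero => simpa using leibniz_map_one hder
  | succ j ih =>
    rw [pow_succ, hder, ih, hdv, mul_one, smul_mul_assoc]
    rcases j with _ | j
    · simp
    · rw [Nat.add_sub_cancel, ← pow_succ, Nat.add_sub_cancel]
      push_cast
      module

include hder hdv hda in
theorem iterate_deriv_atom (j s : ℕ) (b : B) :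
    d^[s] (vGen B ^ j * aGen b) = (j.descFactorial s : ℚ) • (vGen B ^ (j - s) * aGen b) := by
  induction s with
  | zero => simp
  | succ s ih =>
    rw [Function.iterate_succ_apply', ih, map_smul, hder, hda, mul_zero, add_zero,
      deriv_vGen_pow hder hdv, smul_mul_assoc, smul_smul, Nat.descFactorial_succ, Nat.sub_sub]
    push_cast
    rw [mul_comm]

include hder hdv hda in
theorem deriv_mem_atomAlgebra {n : B → ℕ} {w : FreeAlgebra ℚ (B ⊕ Unit)}
    (hw : w ∈ atomAlgebra n) : d w ∈ atomAlgebra n := by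
  induction hw using Algebra.adjoin_induction with
  | mem w hw =>
    obtain ⟨b, j, hj, rfl⟩ := hw
    have h := iterate_deriv_atom hder hdv hda j 1 b
    rw [Function.iterate_one] at h
    rw [h]
    exact Subalgebra.smul_mem _ (atom_mem_atomAlgebra ((Nat.sub_le j 1).trans_lt hj)) _
  | algebraMap r =>
    rw [Algebra.algebraMap_eq_smul_one, map_smul, leibniz_map_one hder, smul_zero]
    exact zero_mem _
  | add w w' _ _ h h' => rw [map_add]; exact add_mem h h'
  | mul w w' hw hw' h h' => rw [hder]; exact add_mem (mul_mem h hw') (mul_mem hw h')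

include hder hdv hda in
theorem iterate_deriv_mem_atomAlgebra {n : B → ℕ} {w : FreeAlgebra ℚ (B ⊕ Unit)}
    (hw : w ∈ atomAlgebra n) (k : ℕ) : d^[k] w ∈ atomAlgebra n := by
  induction k with
  | zero => exact hw
  | succ k ih =>
    rw [Function.iterate_succ_apply']
    exact deriv_mem_atomAlgebra hder hdv hda ih

end Words

section Action

variable {B : Type*} {V : Type*} [AddCommGroup V] [Module ℚ V]
  (n : B → ℕ) (mul' : ℕ → V →ₗ[ℚ] V →ₗ[ℚ] V) (φ₀ : B → V)

/-- The scalar `c` with `(-1)^i (n-1)_i c = 1` for `i = n - 1 - j`. -/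
def atomScalar (N j : ℕ) : ℚ := (-1) ^ (N - 1 - j) * (j.factorial / (N - 1).factorial)

theorem atomScalar_pred (N : ℕ) : atomScalar N (N - 1) = 1 := by
  simp [atomScalar, Nat.factorial_ne_zero]

theorem descFactorial_mul_atomScalar {N j s : ℕ} (hj : j < N) (hs : s ≤ j) :
    (j.descFactorial s : ℚ) * atomScalar N (j - s) = (-1) ^ s * atomScalar N j := by
  have h : ((j - s).factorial : ℚ) * j.descFactorial s = j.factorial := by
    exact_mod_cast Nat.factorial_mul_descFactorial hs
  rw [atomScalar, atomScalar, ← h, show N - 1 - (j - s) = s + (N - 1 - j) by omega, pow_add]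
  ring

/-- Right multiplication by `v^j b` on `V` with a formal left unit adjoined. -/
noncomputable def atomAction (b : B) (j : ℕ) : ℚ × V →ₗ[ℚ] ℚ × V :=
  LinearMap.inr ℚ ℚ V ∘ₗ LinearMap.coprod
    (if j = n b - 1 then LinearMap.toSpanSingleton ℚ V (φ₀ b) else 0)
    (atomScalar (n b) j • (mul' (n b - 1 - j)).flip (φ₀ b))

/-- Right action of the free algebra on `(ℚ ⊕ V)[v]`: the letter `v` shifts the exponent and
a letter `b` multiplies by `v^j b` at the exponent `j`. -/
noncomputable def wordAction :
    FreeAlgebra ℚ (B ⊕ Unit) →ₐ[ℚ] (Module.End ℚ (ℕ →₀ ℚ × V))ᵐᵒᵖ :=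
  FreeAlgebra.lift ℚ (Sum.elim
    (fun b => MulOpposite.op
      (Finsupp.lsum ℚ fun j => Finsupp.lsingle 0 ∘ₗ atomAction n mul' φ₀ b j))
    (fun _ => MulOpposite.op (Finsupp.lmapDomain (ℚ × V) ℚ Nat.succ)))

theorem wordAction_mul (x y : FreeAlgebra ℚ (B ⊕ Unit)) (t : ℕ →₀ ℚ × V) :
    (wordAction n mul' φ₀ (x * y)).unop t =
      (wordAction n mul' φ₀ y).unop ((wordAction n mul' φ₀ x).unop t) := by
  rw [map_mul, MulOpposite.unop_mul, Module.End.mul_apply]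

theorem wordAction_vGen_pow (j : ℕ) (e : ℚ × V) :
    (wordAction n mul' φ₀ (vGen B ^ j)).unop (Finsupp.single 0 e) = Finsupp.single j e := by
  induction j with
  | zero => simp
  | succ j ih =>
    rw [pow_succ, wordAction_mul, ih]
    simp [wordAction, vGen]

theorem wordAction_atom (b : B) (j : ℕ) (e : ℚ × V) :
    (wordAction n mul' φ₀ (vGen B ^ j * aGen b)).unop (Finsupp.single 0 e) =
      Finsupp.single 0 (atomAction n mul' φ₀ b j e) := by
  rw [wordAction_mul, wordAction_vGen_pow]
  simp [wordAction, aGen]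

theorem wordAction_atom_inr (b : B) (j : ℕ) (z : V) :
    (wordAction n mul' φ₀ (vGen B ^ j * aGen b)).unop (Finsupp.single 0 (0, z)) =
      Finsupp.single 0 (0, atomScalar (n b) j • mul' (n b - 1 - j) z (φ₀ b)) := by
  rw [wordAction_atom]
  simp [atomAction]

/-- The image in `V` of the formal unit under the right action of an element of the free
algebra. -/
noncomputable def unitOrbit : FreeAlgebra ℚ (B ⊕ Unit) →ₗ[ℚ] V where
  toFun x := ((wordAction n mul' φ₀ x).unop (Finsupp.single 0 (1, 0)) 0).2
  map_add' x y := by simp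
  map_smul' r x := by simp

end Action

section ConformalAlgebra

variable {B : Type*} {V : Type*} [AddCommGroup V] [Module ℚ V]
  {n : B → ℕ} {mul' : ℕ → V →ₗ[ℚ] V →ₗ[ℚ] V} {φ₀ : B → V}
  (hassoc' : ∀ (a b c : V) (k m : ℕ),
    mul' m (mul' k a b) c = ∑ s ∈ Finset.range (k + 1),
      ((-1 : ℚ) ^ s * (k.choose s : ℚ)) • mul' (k - s) a (mul' (m + s) b c))

include hassoc' in
theorem conformal_assoc_right (a b c : V) (k m : ℕ) :
    mul' k a (mul' m b c) = ∑ s ∈ Finset.range (k + 1),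
      (k.choose s : ℚ) • mul' (m + s) (mul' (k - s) a b) c :=
  binomial_inversion (fun k m => mul' k a (mul' m b c)) (fun k m => mul' m (mul' k a b) c)
    (fun k m => hassoc' a b c k m) k m

include hassoc' in
theorem conformal_mul_local {b c : V} {N : ℕ} (h : ∀ m, N ≤ m → mul' m b c = 0)
    (a : V) (k m : ℕ) (hm : N ≤ m) : mul' m (mul' k a b) c = 0 := by
  rw [hassoc']
  refine Finset.sum_eq_zero fun s _ => ?_
  rw [h _ (hm.trans (Nat.le_add_right m s)), map_zero, smul_zero]

variable {d : FreeAlgebra ℚ (B ⊕ Unit) →ₗ[ℚ] FreeAlgebra ℚ (B ⊕ Unit)}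
  (hder : ∀ x y, d (x * y) = d x * y + x * d y)
  (hdv : d (vGen B) = 1) (hda : ∀ a : B, d (aGen a) = 0) (hn : ∀ a, 1 ≤ n a)
  (hφloc : ∀ (a b : B) (m : ℕ), n b ≤ m → mul' m (φ₀ a) (φ₀ b) = 0)

include hassoc' hder hdv hda hn hφloc in
theorem IsConformalWord.exists_orbit {y : FreeAlgebra ℚ (B ⊕ Unit)} (hy : IsConformalWord n y) :
    ∃ u : V,
      (wordAction n mul' φ₀ y).unop (Finsupp.single 0 (1, 0)) = Finsupp.single 0 (0, u) ∧
      (∀ (b : B) (m : ℕ), n b ≤ m → mul' m u (φ₀ b) = 0) ∧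
      ∀ (k : ℕ) (z : V), (∀ (b : B) (m : ℕ), n b ≤ m → mul' m z (φ₀ b) = 0) →
        (wordAction n mul' φ₀ (d^[k] y)).unop (Finsupp.single 0 (0, z)) =
          Finsupp.single 0 (0, (-1 : ℚ) ^ k • mul' k z u) := by
  induction hy with
  | gen a =>
    refine ⟨φ₀ a, ?_, hφloc a, fun k z hz => ?_⟩
    · rw [wordAction_atom]
      simp [atomAction]
    · rw [iterate_deriv_atom hder hdv hda, map_smul, MulOpposite.unop_smul, LinearMap.smul_apply,
        wordAction_atom_inr, Finsupp.smul_single, Prod.smul_mk, smul_zero, smul_smul]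
      congr 2
      have ha := hn a
      rcases lt_or_ge k (n a) with hk | hk
      · rw [descFactorial_mul_atomScalar (by omega) (by omega), atomScalar_pred, mul_one,
          show n a - 1 - (n a - 1 - k) = k by omega]
      · rw [hz a k hk, Nat.descFactorial_of_lt (by omega)]
        simp
  | @snoc x hx j b hj ih =>
    obtain ⟨u, hu, huloc, hact⟩ := ih
    refine ⟨atomScalar (n b) j • mul' (n b - 1 - j) u (φ₀ b), ?_, fun c m hm => ?_,
      fun k z hz => ?_⟩
    · rw [wordAction_mul, hu, wordAction_atom_inr]
    · rw [map_smul, LinearMap.smul_apply,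
        conformal_mul_local hassoc' (hφloc b c) u _ m hm, smul_zero]
    · have hterm : ∀ s ∈ Finset.range (k + 1),
          (wordAction n mul' φ₀ ((k.choose s : ℚ) •
            (d^[k - s] x * d^[s] (vGen B ^ j * aGen b)))).unop (Finsupp.single 0 (0, z)) =
          Finsupp.single 0 (0, ((-1 : ℚ) ^ k * atomScalar (n b) j) • ((k.choose s : ℚ) •
            mul' (n b - 1 - j + s) (mul' (k - s) z u) (φ₀ b))) := by
        intro s hs
        have hsk : s ≤ k := Nat.lt_succ_iff.mp (Finset.mem_range.mp hs)
        rw [map_smul, MulOpposite.unop_smul, LinearMap.smul_apply, wordAction_mul,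
          hact (k - s) z hz, iterate_deriv_atom hder hdv hda, map_smul, MulOpposite.unop_smul,
          LinearMap.smul_apply, wordAction_atom_inr, map_smul, LinearMap.smul_apply]
        simp only [Finsupp.smul_single, Prod.smul_mk, smul_zero, smul_smul]
        congr 2
        rcases le_or_gt s j with hsj | hsj
        · rw [show n b - 1 - (j - s) = n b - 1 - j + s by omega]
          congr 1
          have hsign : (-1 : ℚ) ^ k = (-1) ^ (k - s) * (-1) ^ s := by
            rw [← pow_add, Nat.sub_add_cancel hsk]
          rw [hsign]
          linear_combination (k.choose s : ℚ) * (-1) ^ (k - s) *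
            descFactorial_mul_atomScalar hj hsj
        · rw [Nat.descFactorial_of_lt hsj,
            conformal_mul_local hassoc' (huloc b) z (k - s) (n b - 1 - j + s) (by omega)]
          simp
      rw [iterate_leibniz d hder, map_sum, Finset.unop_sum, LinearMap.sum_apply,
        Finset.sum_congr rfl hterm, map_smul, conformal_assoc_right hassoc', smul_smul,
        Finset.smul_sum, ← Finsupp.single_finsetSum]
      congr 1
      ext <;> simp [Prod.fst_sum, Prod.snd_sum]

include hassoc' hder hdv hda hn hφloc in
theorem unitOrbit_mul_iterate_deriv {x y : FreeAlgebra ℚ (B ⊕ Unit)}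
    (hx : x ∈ wordSpan n) (hy : y ∈ wordSpan n) (k : ℕ) :
    unitOrbit n mul' φ₀ (x * d^[k] y) =
      (-1 : ℚ) ^ k • mul' k (unitOrbit n mul' φ₀ x) (unitOrbit n mul' φ₀ y) := by
  simp only [← Module.End.pow_apply]
  induction hx using Submodule.span_induction with
  | mem x hx =>
    obtain ⟨u, hu, huloc, -⟩ := hx.exists_orbit hassoc' hder hdv hda hn hφloc
    have hxu : unitOrbit n mul' φ₀ x = u := by simp [unitOrbit, hu]
    induction hy using Submodule.span_induction with
    | mem y hy =>
      obtain ⟨w, hw, -, hact⟩ := hy.exists_orbit hassoc' hder hdv hda hn hφloc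
      have hyw : unitOrbit n mul' φ₀ y = w := by simp [unitOrbit, hw]
      rw [hxu, hyw, Module.End.pow_apply]
      change ((wordAction n mul' φ₀ (x * d^[k] y)).unop (Finsupp.single 0 (1, 0)) 0).2 = _
      rw [wordAction_mul, hu, hact k u huloc, Finsupp.single_eq_same]
    | zero => simp
    | add y y' _ _ h h' => simp only [map_add, mul_add, h, h', smul_add]
    | smul r y _ h => simp only [map_smul, mul_smul_comm, h, smul_comm r]
  | zero => simp
  | add x x' _ _ h h' => simp only [map_add, add_mul, h, h', smul_add, LinearMap.add_apply]
  | smul r x _ h => simp only [map_smul, smul_mul_assoc, h, smul_comm r, LinearMap.smul_apply]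

/-- The extension of `unitOrbit` to polynomials sending `X` to `D'`. -/
noncomputable def conformalLift (n : B → ℕ) (mul' : ℕ → V →ₗ[ℚ] V →ₗ[ℚ] V) (φ₀ : B → V)
    (D' : V →ₗ[ℚ] V) : (FreeAlgebra ℚ (B ⊕ Unit))[X] →ₗ[ℚ] V :=
  Polynomial.lsum fun i => (D' ^ i) ∘ₗ unitOrbit n mul' φ₀

theorem conformalLift_C (D' : V →ₗ[ℚ] V) (x : FreeAlgebra ℚ (B ⊕ Unit)) :
    conformalLift n mul' φ₀ D' (C x) = unitOrbit n mul' φ₀ x := by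
  simp [conformalLift, Polynomial.lsum_apply]

theorem conformalLift_X_mul (D' : V →ₗ[ℚ] V) (p : (FreeAlgebra ℚ (B ⊕ Unit))[X]) :
    conformalLift n mul' φ₀ D' (X * p) = D' (conformalLift n mul' φ₀ D' p) := by
  induction p using Polynomial.induction_on' with
  | add p q hp hq => simp only [mul_add, map_add, hp, hq]
  | monomial i x =>
    rw [X_mul_monomial]
    simp [conformalLift, Polynomial.lsum_apply, pow_succ']

/-- The polynomials with coefficients in `wordSpan n`. -/
noncomputable def wordPolynomials (n : B → ℕ) : Submodule ℚ (FreeAlgebra ℚ (B ⊕ Unit))[X] :=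
  Submodule.span ℚ {p | ∃ (i : ℕ) (x : FreeAlgebra ℚ (B ⊕ Unit)),
    x ∈ wordSpan n ∧ p = X ^ i * C x}

theorem C_mem_wordPolynomials {x : FreeAlgebra ℚ (B ⊕ Unit)} (hx : x ∈ wordSpan n) :
    C x ∈ wordPolynomials n :=
  Submodule.subset_span ⟨0, x, hx, by simp⟩

theorem X_mul_mem_wordPolynomials {p : (FreeAlgebra ℚ (B ⊕ Unit))[X]}
    (hp : p ∈ wordPolynomials n) : X * p ∈ wordPolynomials n := by
  induction hp using Submodule.span_induction with
  | mem p hp =>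
    obtain ⟨i, x, hx, rfl⟩ := hp
    exact Submodule.subset_span ⟨i + 1, x, hx, by rw [pow_succ', mul_assoc]⟩
  | zero => simp
  | add p q _ _ hp hq => rw [mul_add]; exact add_mem hp hq
  | smul r p _ hp => rw [mul_smul_comm]; exact Submodule.smul_mem _ _ hp

include hder hdv hda hn in
theorem mul_iterate_deriv_mem_wordSpan {x y : FreeAlgebra ℚ (B ⊕ Unit)}
    (hx : x ∈ wordSpan n) (hy : y ∈ wordSpan n) (k : ℕ) : x * d^[k] y ∈ wordSpan n := by
  refine mul_mem_wordSpan hx (iterate_deriv_mem_atomAlgebra hder hdv hda ?_ k)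
  have hle : wordSpan n ≤ Subalgebra.toSubmodule (atomAlgebra n) :=
    Submodule.span_le.mpr fun w hw => IsConformalWord.mem_atomAlgebra hn hw
  exact hle hy

variable {mul : ℕ → (FreeAlgebra ℚ (B ⊕ Unit))[X] →ₗ[ℚ]
    (FreeAlgebra ℚ (B ⊕ Unit))[X] →ₗ[ℚ] (FreeAlgebra ℚ (B ⊕ Unit))[X]}
  (hmul₁ : ∀ (p q : (FreeAlgebra ℚ (B ⊕ Unit))[X]) (k : ℕ),
    mul k (X * p) q = -(k : ℚ) • mul (k - 1) p q)
  (hmul₂ : ∀ (p q : (FreeAlgebra ℚ (B ⊕ Unit))[X]) (k : ℕ),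
    mul k p (X * q) = X * mul k p q + (k : ℚ) • mul (k - 1) p q)
  (hmul₃ : ∀ (x y : FreeAlgebra ℚ (B ⊕ Unit)) (k : ℕ),
    mul k (C x) (C y) = ((-1 : ℚ) ^ k) • C (x * (⇑d)^[k] y))
  {D' : V →ₗ[ℚ] V}
  (hsesq₁' : ∀ (a b : V) (k : ℕ), mul' k (D' a) b = -(k : ℚ) • mul' (k - 1) a b)
  (hsesq₂' : ∀ (a b : V) (k : ℕ),
    mul' k a (D' b) = D' (mul' k a b) + (k : ℚ) • mul' (k - 1) a b)

include hassoc' hder hdv hda hn hφloc hmul₁ hmul₂ hmul₃ hsesq₁' hsesq₂' in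
theorem conformalLift_mul {p q : (FreeAlgebra ℚ (B ⊕ Unit))[X]}
    (hp : p ∈ wordPolynomials n) (hq : q ∈ wordPolynomials n) (k : ℕ) :
    mul k p q ∈ wordPolynomials n ∧
      conformalLift n mul' φ₀ D' (mul k p q) =
        mul' k (conformalLift n mul' φ₀ D' p) (conformalLift n mul' φ₀ D' q) := by
  induction hp using Submodule.span_induction with
  | mem p hp =>
    obtain ⟨i, x, hx, rfl⟩ := hp
    induction hq using Submodule.span_induction with
    | mem q hq =>
      obtain ⟨j, y, hy, rfl⟩ := hq
      induction i generalizing k with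
      | zero =>
        rw [pow_zero, one_mul]
        induction j generalizing k with
        | zero =>
          rw [pow_zero, one_mul, hmul₃]
          refine ⟨Submodule.smul_mem _ _ (C_mem_wordPolynomials
            (mul_iterate_deriv_mem_wordSpan hder hdv hda hn hx hy k)), ?_⟩
          rw [map_smul, conformalLift_C, conformalLift_C, conformalLift_C,
            unitOrbit_mul_iterate_deriv hassoc' hder hdv hda hn hφloc hx hy, smul_smul,
            ← mul_pow]
          simp
        | succ j ih =>
          rw [pow_succ', mul_assoc, hmul₂]
          refine ⟨add_mem (X_mul_mem_wordPolynomials (ih k).1)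
            (Submodule.smul_mem _ _ (ih (k - 1)).1), ?_⟩
          rw [map_add, map_smul, conformalLift_X_mul, conformalLift_X_mul, (ih k).2,
            (ih (k - 1)).2, hsesq₂']
      | succ i ih =>
        rw [pow_succ', mul_assoc, hmul₁]
        refine ⟨Submodule.smul_mem _ _ (ih (k - 1)).1, ?_⟩
        rw [map_smul, conformalLift_X_mul, (ih (k - 1)).2, hsesq₁']
    | zero => simp
    | add q q' _ _ h h' =>
      simp only [map_add, h.2, h'.2, and_true]
      exact add_mem h.1 h'.1
    | smul r q _ h =>
      simp only [map_smul, h.2, and_true]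
      exact Submodule.smul_mem _ _ h.1
  | zero => simp
  | add p p' _ _ h h' =>
    simp only [map_add, LinearMap.add_apply, h.2, h'.2, and_true]
    exact add_mem h.1 h'.1
  | smul r p _ h =>
    simp only [map_smul, LinearMap.smul_apply, h.2, and_true]
    exact Submodule.smul_mem _ _ h.1

end ConformalAlgebra

theorem free_conformal_universal_property
    (B : Type*)
    -- the derivation ∂ on F
    (d : FreeAlgebra ℚ (B ⊕ Unit) →ₗ[ℚ] FreeAlgebra ℚ (B ⊕ Unit))
    (hder : ∀ x y, d (x * y) = d x * y + x * d y)
    (hdv : d (vGen B) = 1) (hda : ∀ a : B, d (aGen a) = 0)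
    -- the locality function
    (n : B → ℕ) (hn : ∀ a, 1 ≤ n a)
    -- a family of products on F[X] as in the statement
    (mul : ℕ → (FreeAlgebra ℚ (B ⊕ Unit))[X] →ₗ[ℚ]
      (FreeAlgebra ℚ (B ⊕ Unit))[X] →ₗ[ℚ] (FreeAlgebra ℚ (B ⊕ Unit))[X])
    (hmul₁ : ∀ (p q : (FreeAlgebra ℚ (B ⊕ Unit))[X]) (k : ℕ),
      mul k (X * p) q = -(k : ℚ) • mul (k - 1) p q)
    (hmul₂ : ∀ (p q : (FreeAlgebra ℚ (B ⊕ Unit))[X]) (k : ℕ),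
      mul k p (X * q) = X * mul k p q + (k : ℚ) • mul (k - 1) p q)
    (hmul₃ : ∀ (x y : FreeAlgebra ℚ (B ⊕ Unit)) (k : ℕ),
      mul k (C x) (C y) = ((-1 : ℚ) ^ k) • C (x * (⇑d)^[k] y))
    -- the generators g(a) = C(v^{n(a)-1} * a) and the subalgebra G they generate
    (g : B → (FreeAlgebra ℚ (B ⊕ Unit))[X])
    (hg : ∀ a : B, g a = C ((vGen B) ^ (n a - 1) * aGen a))
    (G : Submodule ℚ (FreeAlgebra ℚ (B ⊕ Unit))[X])
    (hG : G = sInf {S : Submodule ℚ (FreeAlgebra ℚ (B ⊕ Unit))[X] |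
      (∀ a : B, g a ∈ S) ∧ (∀ x ∈ S, X * x ∈ S) ∧
      (∀ (k : ℕ), ∀ x ∈ S, ∀ y ∈ S, mul k x y ∈ S)})
    -- an associative conformal algebra C'
    (C' : Type*) [AddCommGroup C'] [Module ℚ C']
    (D' : C' →ₗ[ℚ] C') (mul' : ℕ → C' →ₗ[ℚ] C' →ₗ[ℚ] C')
    (hloc' : ∀ a b : C', ∃ N : ℕ, ∀ k ≥ N, mul' k a b = 0)
    (hsesq₁' : ∀ (a b : C') (k : ℕ), mul' k (D' a) b = -(k : ℚ) • mul' (k - 1) a b)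
    (hsesq₂' : ∀ (a b : C') (k : ℕ),
      mul' k a (D' b) = D' (mul' k a b) + (k : ℚ) • mul' (k - 1) a b)
    (hassoc' : ∀ (a b c : C') (k m : ℕ),
      mul' m (mul' k a b) c =
        ∑ s ∈ Finset.range (k + 1),
          ((-1 : ℚ) ^ s * (k.choose s : ℚ)) • mul' (k - s) a (mul' (m + s) b c))
    -- a map φ₀ : B → C' respecting the locality function, whose image generates C'
    (φ₀ : B → C')
    (hφloc : ∀ (a b : B) (m : ℕ), n b ≤ m → mul' m (φ₀ a) (φ₀ b) = 0)
    (hφgen : ∀ S : Submodule ℚ C', (∀ a : B, φ₀ a ∈ S) → (∀ x ∈ S, D' x ∈ S) →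
      (∀ (k : ℕ), ∀ x ∈ S, ∀ y ∈ S, mul' k x y ∈ S) → ∀ z : C', z ∈ S) :
    -- conclusion: a surjective linear map Φ : G → C' extending φ₀ and respecting
    -- the derivation and all the products
    ∃ Φ : G →ₗ[ℚ] C',
      Function.Surjective Φ ∧
      (∀ (a : B) (h : g a ∈ G), Φ ⟨g a, h⟩ = φ₀ a) ∧
      (∀ (x : G) (h : (X : (FreeAlgebra ℚ (B ⊕ Unit))[X]) * x.val ∈ G),
        Φ ⟨X * x.val, h⟩ = D' (Φ x)) ∧
      (∀ (k : ℕ) (x y : G) (h : mul k x.val y.val ∈ G),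
        Φ ⟨mul k x.val y.val, h⟩ = mul' k (Φ x) (Φ y)) := by
  have hGg : ∀ a, g a ∈ G := fun a => by
    rw [hG, Submodule.mem_sInf]
    exact fun S hS => hS.1 a
  have hGX : ∀ x ∈ G, X * x ∈ G := fun x hx => by
    rw [hG, Submodule.mem_sInf] at hx ⊢
    exact fun S hS => hS.2.1 x (hx S hS)
  have hGmul : ∀ (k : ℕ), ∀ x ∈ G, ∀ y ∈ G, mul k x y ∈ G := fun k x hx y hy => by
    rw [hG, Submodule.mem_sInf] at hx hy ⊢
    exact fun S hS => hS.2.2 k x (hx S hS) y (hy S hS)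
  have hlift : ∀ p ∈ wordPolynomials n, ∀ q ∈ wordPolynomials n, ∀ k,
      mul k p q ∈ wordPolynomials n ∧ conformalLift n mul' φ₀ D' (mul k p q) =
        mul' k (conformalLift n mul' φ₀ D' p) (conformalLift n mul' φ₀ D' q) :=
    fun p hp q hq k => conformalLift_mul hassoc' hder hdv hda hn hφloc hmul₁ hmul₂ hmul₃
      hsesq₁' hsesq₂' hp hq k
  have hGle : G ≤ wordPolynomials n := by
    rw [hG]
    refine sInf_le ⟨fun a => ?_, fun x hx => X_mul_mem_wordPolynomials hx,
      fun k x hx y hy => (hlift x hx y hy k).1⟩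
    rw [hg]
    exact C_mem_wordPolynomials (Submodule.subset_span (IsConformalWord.gen a))
  have hgen : ∀ a, conformalLift n mul' φ₀ D' (g a) = φ₀ a := fun a => by
    rw [hg, conformalLift_C]
    change ((wordAction n mul' φ₀ _).unop (Finsupp.single 0 (1, 0)) 0).2 = _
    rw [wordAction_atom]
    simp [atomAction]
  refine ⟨(conformalLift n mul' φ₀ D').domRestrict G, fun z => ?_, fun a _ => hgen a,
    fun x _ => conformalLift_X_mul D' x.val,
    fun k x y _ => (hlift _ (hGle x.2) _ (hGle y.2) k).2⟩
  refine hφgen (LinearMap.range ((conformalLift n mul' φ₀ D').domRestrict G))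
    (fun a => ⟨⟨g a, hGg a⟩, hgen a⟩) ?_ ?_ z
  · rintro _ ⟨x, rfl⟩
    exact ⟨⟨X * x.val, hGX _ x.2⟩, conformalLift_X_mul D' x.val⟩
  · rintro k _ ⟨x, rfl⟩ _ ⟨y, rfl⟩
    exact ⟨⟨mul k x.val y.val, hGmul k _ x.2 _ y.2⟩, (hlift _ (hGle x.2) _ (hGle y.2) k).2⟩
end
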